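/- arXiv:1605.04840 — 2 statements merged into one kernel-verified Lean document; each statement's English description precedes it below -/
import Mathlib

section
/- Let Ω ⊂ ℝ² be a closed bounded rectangle and let H ∈ C³(Ω) satisfy H > δ, |H_x| > δ and |H_y| > δ on Ω for some δ > 0, as well as the PDI a² H_xx/H_x² + (1−a²−b²) H_xy/(H_x H_y) + b² H_yy/H_y² ≥ 0 on Ω, where a, b > 0 satisfy |a−b| < 1 and a+b > 1 (equivalently |1−a²−b²| < 2ab). Then there exist constants c = c(H) > 0 and R₀ = R₀(H) such that for all R > R₀, setting p = 4/((1−(a−b)²)((a+b)²−1)) and q = 2(a²−b²−1)/((1−(a−b)²)((a+b)²−1)), one has for all Borel measurable f, g : ℝⁿ → ℝ with (f(x), g(y)) ∈ Ω for all x, y: ∫_{ℝⁿ} ( ∫_{ℝⁿ} H(f((x−y)/a), g(y/b))^R dγ_{p,q,x}(y) )^{1/(R−c)} dγ_n(x) ≥ H( ∫_{ℝⁿ} f dγ_n, ∫_{ℝⁿ} g dγ_n )^{R/(R−c)}. -/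
open MeasureTheory Real Filter

noncomputable section

abbrev Euc (n : ℕ) := EuclideanSpace ℝ (Fin n)

def Hx (H : ℝ × ℝ → ℝ) (z : ℝ × ℝ) : ℝ := fderiv ℝ H z (1, 0)
def Hy (H : ℝ × ℝ → ℝ) (z : ℝ × ℝ) : ℝ := fderiv ℝ H z (0, 1)
def Hxx (H : ℝ × ℝ → ℝ) (z : ℝ × ℝ) : ℝ := fderiv ℝ (Hx H) z (1, 0)
def Hxy (H : ℝ × ℝ → ℝ) (z : ℝ × ℝ) : ℝ := fderiv ℝ (Hx H) z (0, 1)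
def Hyy (H : ℝ × ℝ → ℝ) (z : ℝ × ℝ) : ℝ := fderiv ℝ (Hy H) z (0, 1)

/-- `γ_n`, the standard Gaussian probability measure `(2π)^{−n/2} e^{−|x|²/2} dx` on `ℝⁿ`. -/
def stdGaussian (n : ℕ) : Measure (Euc n) :=
  volume.withDensity fun x =>
    ENNReal.ofReal ((2 * π) ^ (-(n : ℝ) / 2) * Real.exp (-‖x‖ ^ 2 / 2))

/-- The probability measure `dγ_{p,q,x}(y) = (p/(2π))^{n/2} e^{−|py+qx|²/(2p)} dy` on `ℝⁿ`. -/
def gammaPQX (n : ℕ) (p q : ℝ) (x : Euc n) : Measure (Euc n) :=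
  volume.withDensity fun y =>
    ENNReal.ofReal ((p / (2 * π)) ^ ((n : ℝ) / 2) * Real.exp (-‖p • y + q • x‖ ^ 2 / (2 * p)))

open scoped Topology

namespace GaussianHeat

section Heat

variable {V W : Type*} [NormedAddCommGroup V] [NormedSpace ℝ V]
  [MeasurableSpace V] [NormedAddCommGroup W] [NormedSpace ℝ W]

/-- The Gaussian averaging operator `F ↦ ∫ F (· + σ ζ) dμ(ζ)`. -/
def heat (μ : Measure V) (σ : ℝ) (F : V → W) (z : V) : W := ∫ ζ, F (z + σ • ζ) ∂μ

/-- `F` takes values in `K` and has first-order expansions with quadratic error, with continuous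
derivative `G` of norm at most `L` and values in `S`. -/
structure SmoothInto (K : Set W) (S : Set (V →L[ℝ] W)) (L : ℝ) (F : V → W) (G : V → V →L[ℝ] W) :
    Prop where
  mem : ∀ z, F z ∈ K
  cont : Continuous F
  cont_deriv : Continuous G
  deriv_mem : ∀ z, G z ∈ S
  deriv_bound : ∀ z, ‖G z‖ ≤ L
  taylor : ∀ z h, ‖F (z + h) - F z - G z h‖ ≤ L * ‖h‖ ^ 2

lemma abs_quadratic_sub_le {D : W →L[ℝ] W →L[ℝ] ℝ} {M : ℝ} (hD : ‖D‖ ≤ M) (x y : W) :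
    |D x x - D y y| ≤ M * (‖x - y‖ * (‖x‖ + ‖y‖)) := by
  have e : D x x - D y y = D (x - y) x + D y (x - y) := by simp
  rw [e]
  have h1 : |D (x - y) x| ≤ M * ‖x - y‖ * ‖x‖ := by
    simpa using (D.le_opNorm₂ (x - y) x).trans (by gcongr)
  have h2 : |D y (x - y)| ≤ M * ‖y‖ * ‖x - y‖ := by
    simpa using (D.le_opNorm₂ y (x - y)).trans (by gcongr)
  refine (abs_add_le _ _).trans ?_
  linarith

section

variable [BorelSpace V] [FiniteDimensional ℝ V] {μ : Measure V}

lemma integrable_translate [IsProbabilityMeasure μ] {X : Type*} [NormedAddCommGroup X]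
    {F : V → X} {C : ℝ} (hF : Continuous F) (hb : ∀ z, ‖F z‖ ≤ C) (z : V) (σ : ℝ) :
    Integrable (fun ζ => F (z + σ • ζ)) μ := by
  have : SecondCountableTopology V := inferInstance
  refine Integrable.of_bound (C := C) ?_ (ae_of_all _ fun ζ => hb _)
  exact (hF.comp (by fun_prop)).aestronglyMeasurable

lemma continuous_heat [IsProbabilityMeasure μ] {F : V → W} {C : ℝ}
    (hF : Continuous F) (hb : ∀ z, ‖F z‖ ≤ C) (σ : ℝ) : Continuous (heat μ σ F) := by
  refine continuous_of_dominated (bound := fun _ => C) ?_ ?_ (integrable_const C) ?_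
  · intro z
    exact (integrable_translate (μ := μ) hF hb z σ).aestronglyMeasurable
  · intro z
    exact ae_of_all _ fun ζ => hb _
  · exact ae_of_all _ fun ζ => hF.comp (by fun_prop)

variable [FiniteDimensional ℝ W]

lemma smoothInto_heat [IsProbabilityMeasure μ] {K : Set W} {S : Set (V →L[ℝ] W)} {L : ℝ}
    {F : V → W} {G : V → V →L[ℝ] W} (hK : IsCompact K) (hKc : Convex ℝ K) (hS : IsClosed S)
    (hSc : Convex ℝ S) (h : SmoothInto K S L F G) (σ : ℝ) :
    SmoothInto K S L (heat μ σ F) (heat μ σ G) := by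
  obtain ⟨C, hC⟩ := hK.isBounded.exists_norm_le
  have hFb : ∀ z, ‖F z‖ ≤ C := fun z => hC _ (h.mem z)
  have iF := fun z => integrable_translate (μ := μ) h.cont hFb z σ
  have iG := fun z => integrable_translate (μ := μ) h.cont_deriv h.deriv_bound z σ
  refine ⟨fun z => ?_, continuous_heat h.cont hFb σ, continuous_heat h.cont_deriv h.deriv_bound σ,
    fun z => ?_, fun z => ?_, fun z k => ?_⟩
  · exact hKc.integral_mem hK.isClosed (ae_of_all _ fun ζ => h.mem _) (iF z)
  · exact hSc.integral_mem hS (ae_of_all _ fun ζ => h.deriv_mem _) (iG z)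
  · have := norm_integral_le_of_norm_le_const (μ := μ)
      (ae_of_all _ fun ζ => h.deriv_bound (z + σ • ζ))
    simpa [heat] using this
  · have e : heat μ σ F (z + k) - heat μ σ F z
        - heat μ σ G z k
        = ∫ ζ, (F (z + σ • ζ + k) - F (z + σ • ζ) - G (z + σ • ζ) k) ∂μ := by
      have i1 : Integrable (fun ζ => F (z + σ • ζ + k)) μ := by
        simpa only [add_right_comm] using iF (z + k)
      have i3 : Integrable (fun ζ => G (z + σ • ζ) k) μ := (iG z).apply_continuousLinearMap k
      have i2 : Integrable (fun ζ => F (z + σ • ζ + k) - F (z + σ • ζ)) μ := i1.sub (iF z)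
      rw [integral_sub i2 i3, integral_sub i1 (iF z)]
      simp only [heat, ContinuousLinearMap.integral_apply (iG z) k, add_right_comm z k]
    rw [e]
    have := norm_integral_le_of_norm_le_const (μ := μ)
      (ae_of_all _ fun ζ => h.taylor (z + σ • ζ) k)
    simpa using this

/-- Two Gaussian averages of scale `σ` compose to one of scale `√2 σ`. -/
lemma heat_heat [ProbabilityTheory.IsGaussian μ] (hμ : ∫ x, x ∂μ = 0) {F : V → W} {C : ℝ}
    (hF : Continuous F) (hb : ∀ z, ‖F z‖ ≤ C) (σ : ℝ) :
    heat μ σ (heat μ σ F) = heat μ (√2 * σ) F := by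
  have : CompleteSpace V := FiniteDimensional.complete ℝ V
  ext z
  have rot := ProbabilityTheory.IsGaussian.map_rotation_eq_self (by simpa using hμ) (π / 4)
  have law : (μ.prod μ).map (fun p : V × V => (√2)⁻¹ • (p.1 + p.2)) = μ := by
    have h1 := congrArg (fun ν => Measure.map Prod.fst ν) rot
    rw [Measure.map_map (by fun_prop) (by fun_prop), Measure.map_fst_prod] at h1
    simp only [measure_univ, one_smul] at h1
    convert h1 using 2
    ext p
    have : (√2)⁻¹ = √2 / 2 := by
      rw [inv_eq_one_div, div_eq_div_iff (by positivity) (by norm_num)]; simp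
    simp [ContinuousLinearMap.rotation_apply, this]
  have e1 : heat μ (√2 * σ) F z = ∫ p : V × V, F (z + σ • p.1 + σ • p.2) ∂(μ.prod μ) := by
    unfold heat
    conv_lhs => rw [← law]
    have hFz : Continuous fun ζ : V => F (z + (√2 * σ) • ζ) := hF.comp (by fun_prop)
    rw [integral_map (by fun_prop) hFz.aestronglyMeasurable]
    refine integral_congr_ae (ae_of_all _ fun p => ?_)
    simp only [smul_smul, mul_right_comm √2 σ, smul_add]
    rw [mul_inv_cancel₀ (by positivity), one_mul, add_assoc]
  have hF2 : Continuous fun p : V × V => F (z + σ • p.1 + σ • p.2) := hF.comp (by fun_prop)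
  have i2 : Integrable (fun p : V × V => F (z + σ • p.1 + σ • p.2)) (μ.prod μ) :=
    Integrable.of_bound (C := C) hF2.aestronglyMeasurable (ae_of_all _ fun p => hb _)
  rw [e1, integral_prod _ i2]
  rfl


lemma integrable_pow_norm [ProbabilityTheory.IsGaussian μ] :
    Integrable (fun ζ : V => (1 + ‖ζ‖) ^ 6) μ := by
  have : CompleteSpace V := FiniteDimensional.complete ℝ V
  have h := ProbabilityTheory.IsGaussian.memLp_id μ 6 (by norm_num)
  have h1 : MemLp (fun ζ : V => 1 + ‖ζ‖) 6 μ := (memLp_const (1 : ℝ)).add h.norm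
  have h2 := h1.integrable_norm_pow (p := 6) (by norm_num)
  refine h2.congr (ae_of_all _ fun ζ => ?_)
  simp only [Real.norm_eq_abs]
  rw [abs_of_nonneg (by positivity)]

/-- A function `B` with second-order Taylor expansions on `K` whose Hessian has nonnegative
Gaussian average along every `A ∈ S`. -/
structure HessianNonneg (μ : Measure V) (K : Set W) (S : Set (V →L[ℝ] W)) (M : ℝ) (B : W → ℝ)
    (D₁ : W → W →L[ℝ] ℝ) (D₂ : W → W →L[ℝ] W →L[ℝ] ℝ) : Prop where
  cont : ContinuousOn B K
  bound : ∀ w ∈ K, ‖D₂ w‖ ≤ M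
  diam : ∀ w ∈ K, ∀ w' ∈ K, ‖w' - w‖ ≤ M
  taylor : ∀ w ∈ K, ∀ w' ∈ K,
    |B w' - B w - D₁ w (w' - w) - 1 / 2 * D₂ w (w' - w) (w' - w)| ≤ M * ‖w' - w‖ ^ 3
  nonneg : ∀ w ∈ K, ∀ A ∈ S, 0 ≤ ∫ ζ, D₂ w (A ζ) (A ζ) ∂μ

lemma exists_heat_step [ProbabilityTheory.IsGaussian μ] (hμ : ∫ x, x ∂μ = 0) {K : Set W}
    {S : Set (V →L[ℝ] W)} {M L : ℝ} {B : W → ℝ} {D₁ : W → W →L[ℝ] ℝ}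
    {D₂ : W → W →L[ℝ] W →L[ℝ] ℝ} (hK : IsCompact K) (hKc : Convex ℝ K)
    (hB : HessianNonneg μ K S M B D₁ D₂) (hL : 0 ≤ L) (hM : 0 ≤ M) :
    ∃ C, ∀ F G, SmoothInto K S L F G → ∀ σ, 0 ≤ σ → σ ≤ 1 → ∀ z,
      B (heat μ σ F z) ≤ heat μ σ (B ∘ F) z + C * σ ^ 3 := by
  have : CompleteSpace V := FiniteDimensional.complete ℝ V
  set κ := ∫ ζ : V, (1 + ‖ζ‖) ^ 6 ∂μ with hκ
  refine ⟨(M * L ^ 2 + M * L ^ 3) * κ + (M / 2 + M * M) * (L * κ) ^ 2, ?_⟩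
  intro F G h σ hσ hσ1 z
  obtain ⟨C, hC⟩ := hK.isBounded.exists_norm_le
  obtain ⟨C', hC'⟩ := (hK.image_of_continuousOn hB.cont).isBounded.exists_norm_le
  have hFb : ∀ z, ‖F z‖ ≤ C := fun z => hC _ (h.mem z)
  have iF := integrable_translate (μ := μ) h.cont hFb z σ
  have hBF : Continuous (B ∘ F) := hB.cont.comp_continuous h.cont h.mem
  have iBF := integrable_translate (μ := μ) hBF
    (fun z => hC' _ (Set.mem_image_of_mem B (h.mem z))) z σ
  have iκ := integrable_pow_norm (μ := μ)
  set w := F z with hw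
  set A := G z with hA
  set m := heat μ σ F z with hm
  have hwK : w ∈ K := h.mem z
  have hmK : m ∈ K := hKc.integral_mem hK.isClosed (ae_of_all _ fun ζ => h.mem _) iF
  have iid : Integrable (fun ζ : V => ζ) μ :=
    ProbabilityTheory.IsGaussian.integrable_id
  have iA : Integrable (fun ζ : V => A ζ) μ := A.integrable_comp iid
  have iΔ : Integrable (fun ζ => F (z + σ • ζ) - w) μ := iF.sub (integrable_const w)
  have hA0 : ∫ ζ, A ζ ∂μ = 0 := by
    rw [A.integral_comp_comm iid, hμ, map_zero]
  have hmw : ∫ ζ, (F (z + σ • ζ) - w) ∂μ = m - w := by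
    rw [integral_sub iF (integrable_const w)]; simp [hm, heat]
  have hρ : ∀ ζ, ‖F (z + σ • ζ) - w - σ • A ζ‖ ≤ L * σ ^ 2 * ‖ζ‖ ^ 2 := fun ζ => by
    have := h.taylor z (σ • ζ)
    rw [norm_smul, mul_pow, Real.norm_eq_abs, sq_abs, map_smul] at this
    linarith
  have hAb : ∀ ζ, ‖σ • A ζ‖ ≤ L * σ * ‖ζ‖ := fun ζ => by
    rw [norm_smul, Real.norm_eq_abs, abs_of_nonneg hσ]
    have := (A.le_opNorm ζ).trans (mul_le_mul_of_nonneg_right (h.deriv_bound z) (norm_nonneg ζ))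
    nlinarith
  have hΔ : ∀ ζ, ‖F (z + σ • ζ) - w‖ ≤ L * σ * (1 + ‖ζ‖) ^ 2 := fun ζ => by
    have h1 := norm_add_le (F (z + σ • ζ) - w - σ • A ζ) (σ • A ζ)
    rw [sub_add_cancel] at h1
    have h2 : σ ^ 2 ≤ σ := by nlinarith
    have h3 : L * σ ^ 2 * ‖ζ‖ ^ 2 ≤ L * σ * ‖ζ‖ ^ 2 := by gcongr
    have h4 := hρ ζ
    have h5 := hAb ζ
    have h6 : 0 ≤ L * σ := by positivity
    nlinarith [norm_nonneg ζ, mul_nonneg h6 (norm_nonneg ζ)]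
  have hmb : ‖m - w‖ ≤ L * σ ^ 2 * κ := by
    have e : m - w = ∫ ζ, (F (z + σ • ζ) - w - σ • A ζ) ∂μ := by
      have iσA : Integrable (fun ζ => σ • A ζ) μ := iA.smul σ
      rw [integral_sub iΔ iσA, integral_smul, hA0, hmw]; simp
    rw [e, hκ, ← integral_const_mul]
    refine norm_integral_le_of_norm_le (iκ.const_mul _) (ae_of_all _ fun ζ => (hρ ζ).trans ?_)
    have : ‖ζ‖ ^ 2 ≤ (1 + ‖ζ‖) ^ 6 :=
      (pow_le_pow_left₀ (norm_nonneg _) (by linarith) 2).trans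
        (pow_le_pow_right₀ (by linarith [norm_nonneg ζ]) (by norm_num))
    gcongr
  have up : B m ≤ B w + D₁ w (m - w) + (M / 2 + M * M) * (L * κ) ^ 2 * σ ^ 3 := by
    have t := (abs_le.1 (hB.taylor w hwK m hmK)).2
    have q : D₂ w (m - w) (m - w) ≤ M * ‖m - w‖ ^ 2 := by
      have := (le_abs_self _).trans ((D₂ w).le_opNorm₂ (m - w) (m - w))
      have h2 := hB.bound w hwK
      have h3 : ‖D₂ w‖ * ‖m - w‖ * ‖m - w‖ ≤ M * ‖m - w‖ * ‖m - w‖ := by gcongr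
      nlinarith
    have c : M * ‖m - w‖ ^ 3 ≤ M * M * ‖m - w‖ ^ 2 := by
      have := hB.diam w hwK m hmK
      have h3 : ‖m - w‖ ^ 2 * ‖m - w‖ ≤ ‖m - w‖ ^ 2 * M := by gcongr
      nlinarith
    have s : ‖m - w‖ ^ 2 ≤ (L * κ) ^ 2 * σ ^ 3 := by
      have h1 : ‖m - w‖ ^ 2 ≤ (L * σ ^ 2 * κ) ^ 2 := by gcongr
      have h2 : σ ^ 4 ≤ σ ^ 3 := pow_le_pow_of_le_one hσ hσ1 (by norm_num)
      have h3 : (L * κ) ^ 2 * σ ^ 4 ≤ (L * κ) ^ 2 * σ ^ 3 := by gcongr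
      nlinarith
    have s' : (M / 2 + M * M) * ‖m - w‖ ^ 2 ≤ (M / 2 + M * M) * ((L * κ) ^ 2 * σ ^ 3) := by
      gcongr
    nlinarith
  have low : ∀ ζ, B w + D₁ w (F (z + σ • ζ) - w) + 1 / 2 * σ ^ 2 * D₂ w (A ζ) (A ζ)
      - σ ^ 3 * (M * L ^ 2 + M * L ^ 3) * (1 + ‖ζ‖) ^ 6 ≤ B (F (z + σ • ζ)) := fun ζ => by
    have t := (abs_le.1 (hB.taylor w hwK _ (h.mem (z + σ • ζ)))).1
    have q := (abs_le.1 (abs_quadratic_sub_le (hB.bound w hwK) (F (z + σ • ζ) - w)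
      (σ • A ζ))).1
    have e : D₂ w (σ • A ζ) (σ • A ζ) = σ ^ 2 * D₂ w (A ζ) (A ζ) := by
      simp; ring
    rw [e] at q
    have u := norm_nonneg ζ
    set x := ‖ζ‖
    have c : M * ‖F (z + σ • ζ) - w‖ ^ 3 ≤ σ ^ 3 * (M * L ^ 3) * (1 + x) ^ 6 := by
      calc _ ≤ M * (L * σ * (1 + x) ^ 2) ^ 3 := by gcongr; exact hΔ ζ
        _ = _ := by ring
    have d : M * (‖F (z + σ • ζ) - w - σ • A ζ‖ * (‖F (z + σ • ζ) - w‖ + ‖σ • A ζ‖)) ≤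
        2 * (σ ^ 3 * (M * L ^ 2) * (1 + x) ^ 6) := by
      calc _ ≤ M * ((L * σ ^ 2 * (1 + x) ^ 2) * (L * σ * (1 + x) ^ 2 + L * σ * (1 + x) ^ 2)) := by
            gcongr
            · exact (hρ ζ).trans (by gcongr; linarith)
            · exact hΔ ζ
            · exact (hAb ζ).trans (by gcongr; nlinarith)
        _ = 2 * (σ ^ 3 * (M * L ^ 2) * (1 + x) ^ 4) := by ring
        _ ≤ _ := by gcongr <;> linarith
    nlinarith
  have iQ : Integrable (fun ζ => D₂ w (A ζ) (A ζ)) μ := by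
    refine (iκ.const_mul (M * L ^ 2)).mono' (by fun_prop) (ae_of_all _ fun ζ => ?_)
    have h1 := (D₂ w).le_opNorm₂ (A ζ) (A ζ)
    have h2 := (A.le_opNorm ζ).trans (mul_le_mul_of_nonneg_right (h.deriv_bound z) (norm_nonneg ζ))
    have h3 : ‖ζ‖ ^ 2 ≤ (1 + ‖ζ‖) ^ 6 :=
      (pow_le_pow_left₀ (norm_nonneg _) (by linarith) 2).trans
        (pow_le_pow_right₀ (by linarith [norm_nonneg ζ]) (by norm_num))
    calc _ ≤ _ := h1
      _ ≤ M * (L * ‖ζ‖) * (L * ‖ζ‖) := by gcongr; exact hB.bound w hwK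
      _ = M * L ^ 2 * ‖ζ‖ ^ 2 := by ring
      _ ≤ _ := by gcongr
  have iD : Integrable (fun ζ => D₁ w (F (z + σ • ζ) - w)) μ := (D₁ w).integrable_comp iΔ
  have i1 : Integrable (fun ζ => B w + D₁ w (F (z + σ • ζ) - w)) μ := (integrable_const _).add iD
  have i2 : Integrable (fun ζ => B w + D₁ w (F (z + σ • ζ) - w)
      + 1 / 2 * σ ^ 2 * D₂ w (A ζ) (A ζ)) μ := i1.add (iQ.const_mul _)
  have key := integral_mono (i2.sub (iκ.const_mul (σ ^ 3 * (M * L ^ 2 + M * L ^ 3)))) iBF low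
  have e : ∫ ζ, (B w + D₁ w (F (z + σ • ζ) - w) + 1 / 2 * σ ^ 2 * D₂ w (A ζ) (A ζ)
      - σ ^ 3 * (M * L ^ 2 + M * L ^ 3) * (1 + ‖ζ‖) ^ 6) ∂μ = B w + D₁ w (m - w)
      + 1 / 2 * σ ^ 2 * ∫ ζ, D₂ w (A ζ) (A ζ) ∂μ - σ ^ 3 * (M * L ^ 2 + M * L ^ 3) * κ := by
    rw [integral_sub i2 (iκ.const_mul _), integral_add i1 (iQ.const_mul _),
      integral_add (integrable_const _) iD, (D₁ w).integral_comp_comm iΔ, hmw,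
      integral_const_mul, integral_const_mul]
    simp [hκ]
  have key' : B w + D₁ w (m - w)
      + 1 / 2 * σ ^ 2 * ∫ ζ, D₂ w (A ζ) (A ζ) ∂μ - σ ^ 3 * (M * L ^ 2 + M * L ^ 3) * κ
      ≤ heat μ σ (B ∘ F) z := by
    rw [← e]; exact key
  have pos : 0 ≤ 1 / 2 * σ ^ 2 * ∫ ζ, D₂ w (A ζ) (A ζ) ∂μ :=
    mul_nonneg (by positivity) (hB.nonneg w hwK A (h.deriv_mem z))
  nlinarith

/-- Jensen's inequality along the Gaussian semigroup, for functions whose Hessian is nonnegative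
only in the directions allowed by the derivative constraint `S`. -/
theorem le_integral_comp [ProbabilityTheory.IsGaussian μ] (hμ : ∫ x, x ∂μ = 0) {K : Set W}
    {S : Set (V →L[ℝ] W)} {M L : ℝ} {B : W → ℝ} {D₁ : W → W →L[ℝ] ℝ}
    {D₂ : W → W →L[ℝ] W →L[ℝ] ℝ} (hK : IsCompact K) (hKc : Convex ℝ K) (hS : IsClosed S)
    (hSc : Convex ℝ S) (hB : HessianNonneg μ K S M B D₁ D₂) (hM : 0 ≤ M)
    {F : V → W} {G : V → V →L[ℝ] W} (h : SmoothInto K S L F G) :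
    B (∫ ζ, F ζ ∂μ) ≤ ∫ ζ, B (F ζ) ∂μ := by
  have hL : 0 ≤ L := (norm_nonneg _).trans (h.deriv_bound 0)
  obtain ⟨C, hC⟩ := exists_heat_step hμ hK hKc hB hL hM
  obtain ⟨C₁, hC₁⟩ := hK.isBounded.exists_norm_le
  obtain ⟨C₂, hC₂⟩ := (hK.image_of_continuousOn hB.cont).isBounded.exists_norm_le
  have iter : ∀ (k : ℕ) (σ : ℝ), 0 ≤ σ → σ ≤ 1 → ∀ F G, SmoothInto K S L F G → ∀ z,
      B (heat μ (√2 ^ k * σ) F z) ≤ heat μ (√2 ^ k * σ) (B ∘ F) z + 2 ^ k * (C * σ ^ 3) := by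
    intro k
    induction k with
    | zero => intro σ h0 h1 F G h z; simpa using hC F G h σ h0 h1 z
    | succ k ih =>
      intro σ h0 h1 F G h z
      set τ := √2 ^ k * σ
      have hFb : ∀ z, ‖F z‖ ≤ C₁ := fun z => hC₁ _ (h.mem z)
      have hBb : ∀ {F G}, SmoothInto K S L F G → ∀ z, ‖(B ∘ F) z‖ ≤ C₂ := fun h z =>
        hC₂ _ (Set.mem_image_of_mem B (h.mem z))
      have hBF : Continuous (B ∘ F) := hB.cont.comp_continuous h.cont h.mem
      have hP := smoothInto_heat (μ := μ) hK hKc hS hSc h τ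
      have hBP : Continuous (B ∘ heat μ τ F) := hB.cont.comp_continuous hP.cont hP.mem
      have e : √2 ^ (k + 1) * σ = √2 * τ := by simp only [τ]; ring
      rw [e, ← heat_heat hμ h.cont hFb, ← heat_heat hμ hBF (hBb h)]
      have s1 := ih σ h0 h1 _ _ hP z
      have s2 : heat μ τ (B ∘ heat μ τ F) z
          ≤ heat μ τ (heat μ τ (B ∘ F)) z + 2 ^ k * (C * σ ^ 3) := by
        have i2 := integrable_translate (μ := μ)
          (continuous_heat (μ := μ) hBF (hBb h) τ) (C := C₂) (fun z => by
            have := norm_integral_le_of_norm_le_const (μ := μ)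
              (ae_of_all _ fun ζ => hBb h (z + τ • ζ))
            simpa [heat] using this) z τ
        have := integral_mono (integrable_translate (μ := μ) hBP (hBb hP) z τ)
          (i2.add (integrable_const (2 ^ k * (C * σ ^ 3))))
          (fun ζ => ih σ h0 h1 _ _ h (z + τ • ζ))
        simp only [Pi.add_apply] at this
        rw [integral_add i2 (integrable_const _)] at this
        simpa [heat] using this
      rw [pow_succ]
      linarith
  have lim : Tendsto (fun k : ℕ => (∫ ζ, B (F ζ) ∂μ) + C * ((√2)⁻¹) ^ k) atTop
      (𝓝 ((∫ ζ, B (F ζ) ∂μ) + C * 0)) := by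
    refine tendsto_const_nhds.add (Tendsto.const_mul C ?_)
    refine tendsto_pow_atTop_nhds_zero_of_lt_one (by positivity) ?_
    exact inv_lt_one_of_one_lt₀ (by rw [Real.lt_sqrt] <;> norm_num)
  rw [mul_zero, add_zero] at lim
  refine ge_of_tendsto' lim fun k => ?_
  have hs : 0 < √2 := by positivity
  have hs1 : 1 ≤ √2 := by rw [Real.le_sqrt] <;> norm_num
  have := iter k ((√2)⁻¹ ^ k) (by positivity)
    (pow_le_one₀ (by positivity) (inv_le_one_of_one_le₀ hs1)) F G h 0
  have e1 : √2 ^ k * (√2)⁻¹ ^ k = 1 := by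
    rw [← mul_pow, mul_inv_cancel₀ hs.ne', one_pow]
  have e2 : (2 : ℝ) ^ k * (C * ((√2)⁻¹ ^ k) ^ 3) = C * (√2)⁻¹ ^ k := by
    have : (2 : ℝ) ^ k = √2 ^ k * √2 ^ k := by
      rw [← mul_pow, Real.mul_self_sqrt (by norm_num)]
    rw [this]
    linear_combination C * (√2)⁻¹ ^ k * (√2 ^ k * (√2)⁻¹ ^ k + 1) * e1
  rw [e1, e2] at this
  simpa [heat] using this

end

end Heat

section Taylor

variable {W : Type*} [NormedAddCommGroup W] [NormedSpace ℝ W]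

lemma exists_norm_fderiv_le {X : Type*} [NormedAddCommGroup X] [NormedSpace ℝ X] {f : W → X}
    {U K : Set W} (hU : IsOpen U) (hKU : K ⊆ U) (hK : IsCompact K) (hf : ContDiffOn ℝ 1 f U) :
    ∃ C, ∀ w ∈ K, ‖fderiv ℝ f w‖ ≤ C :=
  hK.exists_bound_of_continuousOn
    ((hf.continuousOn_fderiv_of_isOpen hU le_rfl).mono hKU)

/-- Second-order Taylor expansion with uniform cubic remainder on a compact convex set. -/
lemma exists_taylor_bound {B : W → ℝ} {U K : Set W} (hU : IsOpen U) (hKU : K ⊆ U)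
    (hK : IsCompact K) (hKc : Convex ℝ K) (hB : ContDiffOn ℝ 3 B U) :
    ∃ M, 0 ≤ M ∧ (∀ w ∈ K, ‖fderiv ℝ (fderiv ℝ B) w‖ ≤ M) ∧
      (∀ w ∈ K, ∀ w' ∈ K, ‖w' - w‖ ≤ M) ∧
      ∀ w ∈ K, ∀ w' ∈ K, |B w' - B w - fderiv ℝ B w (w' - w)
        - 1 / 2 * fderiv ℝ (fderiv ℝ B) w (w' - w) (w' - w)| ≤ M * ‖w' - w‖ ^ 3 := by
  have h1 : ContDiffOn ℝ 2 (fderiv ℝ B) U := hB.fderiv_of_isOpen hU (by norm_num)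
  have h2 : ContDiffOn ℝ 1 (fderiv ℝ (fderiv ℝ B)) U := h1.fderiv_of_isOpen hU (by norm_num)
  obtain ⟨M₂, hM₂⟩ := exists_norm_fderiv_le hU hKU hK (h1.of_le (by norm_num))
  obtain ⟨M₃, hM₃⟩ := exists_norm_fderiv_le hU hKU hK h2
  obtain ⟨d, hd⟩ := hK.isBounded.exists_norm_le
  have dB : ∀ w ∈ U, HasFDerivAt B (fderiv ℝ B w) w := fun w hw =>
    ((hB.differentiableOn (by norm_num)).differentiableAt (hU.mem_nhds hw)).hasFDerivAt
  have dD : ∀ w ∈ U, HasFDerivAt (fderiv ℝ B) (fderiv ℝ (fderiv ℝ B) w) w := fun w hw =>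
    ((h1.differentiableOn (by norm_num)).differentiableAt (hU.mem_nhds hw)).hasFDerivAt
  have dH : ∀ w ∈ U, HasFDerivAt (fderiv ℝ (fderiv ℝ B))
      (fderiv ℝ (fderiv ℝ (fderiv ℝ B)) w) w := fun w hw =>
    ((h2.differentiableOn (by norm_num)).differentiableAt (hU.mem_nhds hw)).hasFDerivAt
  have sym : ∀ w ∈ U, ∀ u v, fderiv ℝ (fderiv ℝ B) w u v = fderiv ℝ (fderiv ℝ B) w v u := by
    intro w hw u v
    exact (((hB.contDiffAt (hU.mem_nhds hw)).isSymmSndFDerivAt (by simp; norm_num)) u v)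
  refine ⟨max (max M₂ M₃) (max (d + d) 0), ?_, ?_, ?_, ?_⟩
  · exact le_max_of_le_right (le_max_right _ _)
  · exact fun w hw => (hM₂ _ hw).trans
      ((le_max_left _ _).trans (le_max_left _ _))
  · exact fun w hw w' hw' => (norm_sub_le _ _).trans
      ((add_le_add (hd _ hw') (hd _ hw)).trans ((le_max_left _ _).trans (le_max_right _ _)))
  intro w hw w' hw'
  have seg : segment ℝ w w' ⊆ K := hKc.segment_subset hw hw'
  have cs := convex_segment (𝕜 := ℝ) w w'
  have dist_le : ∀ x ∈ segment ℝ w w', ‖x - w‖ ≤ ‖w' - w‖ := fun x hx => by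
    have := norm_sub_le_of_mem_segment hx
    simpa using this
  have lip : ∀ x ∈ segment ℝ w w',
      ‖fderiv ℝ (fderiv ℝ B) x - fderiv ℝ (fderiv ℝ B) w‖ ≤ M₃ * ‖w' - w‖ := fun x hx => by
    have hM0 : 0 ≤ M₃ := (norm_nonneg _).trans (hM₃ _ hw)
    refine (hKc.norm_image_sub_le_of_norm_hasFDerivWithin_le
      (fun y hy => (dH y (hKU hy)).hasFDerivWithinAt)
      (fun y hy => hM₃ _ hy) hw (seg hx)).trans ?_
    exact mul_le_mul_of_nonneg_left (dist_le x hx) hM0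
  have lip1 : ∀ x ∈ segment ℝ w w',
      ‖fderiv ℝ B x - fderiv ℝ B w - fderiv ℝ (fderiv ℝ B) w (x - w)‖ ≤ M₃ * ‖w' - w‖ ^ 2 :=
    fun x hx => by
    have := cs.norm_image_sub_le_of_norm_hasFDerivWithin_le
      (f := fun y => fderiv ℝ B y - fderiv ℝ (fderiv ℝ B) w y)
      (fun y hy => ((dD y (hKU (seg hy))).sub
        (fderiv ℝ (fderiv ℝ B) w).hasFDerivAt).hasFDerivWithinAt)
      (fun y hy => lip y hy) (left_mem_segment ℝ w w') hx
    have hM0 : 0 ≤ M₃ := (norm_nonneg _).trans (hM₃ _ hw)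
    have e : fderiv ℝ B x - fderiv ℝ B w - fderiv ℝ (fderiv ℝ B) w (x - w) =
        fderiv ℝ B x - fderiv ℝ (fderiv ℝ B) w x
          - (fderiv ℝ B w - fderiv ℝ (fderiv ℝ B) w w) := by
      rw [map_sub]; abel
    rw [e]
    refine this.trans ?_
    rw [pow_two, ← mul_assoc]
    exact mul_le_mul_of_nonneg_left (dist_le x hx) (by positivity)
  have main := cs.norm_image_sub_le_of_norm_hasFDerivWithin_le
      (f := fun y => B y - fderiv ℝ B w y
        - 1 / 2 * fderiv ℝ (fderiv ℝ B) w (y - w) (y - w))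
      (f' := fun y => fderiv ℝ B y - fderiv ℝ B w - fderiv ℝ (fderiv ℝ B) w (y - w))
      (fun y hy => by
        have hid : HasFDerivAt (fun y : W => y - w) (ContinuousLinearMap.id ℝ W) y :=
          (hasFDerivAt_id y).sub_const w
        have hq := ((fderiv ℝ (fderiv ℝ B) w).hasFDerivAt_of_bilinear hid hid).const_mul (1 / 2)
        refine ((((dB y (hKU (seg hy))).sub (fderiv ℝ B w).hasFDerivAt).sub
          hq).congr_fderiv ?_).hasFDerivWithinAt
        ext v
        simp [sym w (hKU hw) v]
        ring)
      (fun y hy => lip1 y hy) (left_mem_segment ℝ w w') (right_mem_segment ℝ w w')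
  have e : B w' - B w - fderiv ℝ B w (w' - w)
        - 1 / 2 * fderiv ℝ (fderiv ℝ B) w (w' - w) (w' - w) =
      (B w' - fderiv ℝ B w w' - 1 / 2 * fderiv ℝ (fderiv ℝ B) w (w' - w) (w' - w)) -
      (B w - fderiv ℝ B w w - 1 / 2 * fderiv ℝ (fderiv ℝ B) w (w - w) (w - w)) := by
    simp; ring
  rw [e, ← Real.norm_eq_abs]
  refine main.trans ?_
  have : M₃ ≤ max (max M₂ M₃) (max (d + d) 0) := (le_max_right _ _).trans (le_max_left _ _)
  calc _ = M₃ * ‖w' - w‖ ^ 3 := by ring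
    _ ≤ _ := by gcongr

end Taylor

section Trace

variable {E : Type*} [NormedAddCommGroup E] [InnerProductSpace ℝ E] [FiniteDimensional ℝ E]
  [MeasurableSpace E] [BorelSpace E]

open ProbabilityTheory

/-- The second moments of the standard Gaussian measure are given by the inner product. -/
lemma integral_inner_mul_inner_stdGaussian (x y : E) :
    ∫ ζ, inner ℝ x ζ * inner ℝ y ζ ∂(ProbabilityTheory.stdGaussian E) = inner ℝ x y := by
  have h := covarianceBilin_apply (μ := ProbabilityTheory.stdGaussian E)
    IsGaussian.memLp_two_id x y
  rw [covarianceBilin_stdGaussian] at h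
  rw [← innerSL_apply_apply ℝ x y, h]
  simp [integral_id_stdGaussian]

lemma integrable_bilin {V : Type*} [NormedAddCommGroup V] [NormedSpace ℝ V]
    [FiniteDimensional ℝ V] [MeasurableSpace V] [BorelSpace V] {μ : Measure V}
    [IsGaussian μ] (Q : V →L[ℝ] V →L[ℝ] ℝ) : Integrable (fun ζ => Q ζ ζ) μ := by
  have : SecondCountableTopology V := have := FiniteDimensional.proper_real V; inferInstance
  have h2 : MemLp (fun x : V => x) 2 μ := IsGaussian.memLp_two_id
  refine (h2.integrable_norm_pow (by norm_num)).const_mul ‖Q‖ |>.mono'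
    (by fun_prop) (ae_of_all _ fun ζ => ?_)
  refine (Q.le_opNorm₂ ζ ζ).trans (le_of_eq ?_)
  simp; ring

/-- The mean of a quadratic form under the standard Gaussian measure is its trace. -/
lemma integral_bilin_stdGaussian {ι : Type*} [Fintype ι] (e : OrthonormalBasis ι ℝ E)
    (Q : E →L[ℝ] E →L[ℝ] ℝ) :
    ∫ ζ, Q ζ ζ ∂(ProbabilityTheory.stdGaussian E) = ∑ i, Q (e i) (e i) := by
  have hQ : ∀ ζ : E, Q ζ ζ = ∑ i, ∑ j, inner ℝ (e i) ζ * inner ℝ (e j) ζ * Q (e i) (e j) := by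
    intro ζ
    conv_lhs => rw [← e.sum_repr' ζ]
    simp only [map_sum, map_smul, sum_apply, smul_apply, smul_eq_mul, Finset.mul_sum, mul_assoc]
    rw [Finset.sum_comm]
    exact Finset.sum_congr rfl fun i _ => Finset.sum_congr rfl fun j _ => by ring
  have hi : ∀ i j, Integrable (fun ζ => inner ℝ (e i) ζ * inner ℝ (e j) ζ * Q (e i) (e j))
      (ProbabilityTheory.stdGaussian E) := by
    intro i j
    refine Integrable.mul_const ?_ _
    exact integrable_bilin (((ContinuousLinearMap.mul ℝ ℝ).bilinearComp (innerSL ℝ (e i))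
      (innerSL ℝ (e j))))
  classical
  simp_rw [hQ]
  rw [integral_finsetSum _ fun i _ => integrable_finsetSum _ fun j _ => hi i j]
  simp_rw [integral_finsetSum _ fun j _ => hi _ j, integral_mul_const,
    integral_inner_mul_inner_stdGaussian, e.inner_eq_ite]
  simp

lemma integral_bilin_prod_stdGaussian {ι : Type*} [Fintype ι] (e : OrthonormalBasis ι ℝ E)
    (Q : E × E →L[ℝ] E × E →L[ℝ] ℝ) :
    ∫ ζ, Q ζ ζ ∂((ProbabilityTheory.stdGaussian E).prod (ProbabilityTheory.stdGaussian E)) =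
      ∑ i, (Q (e i, 0) (e i, 0) + Q (0, e i) (0, e i)) := by
  set γ := ProbabilityTheory.stdGaussian E
  let l := ContinuousLinearMap.inl ℝ E E
  let r := ContinuousLinearMap.inr ℝ E E
  rw [integral_prod _ (integrable_bilin Q)]
  have inner_int : ∀ x, ∫ y, Q (x, y) (x, y) ∂γ =
      Q.bilinearComp l l x x + ∑ i, Q (0, e i) (0, e i) := by
    intro x
    have h1 : ∀ y, Q (x, y) (x, y) = Q.bilinearComp l l x x
        + (Q.bilinearComp l r x y + Q.bilinearComp r l y x) + Q.bilinearComp r r y y := by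
      intro y
      have e1 : ((x, y) : E × E) = l x + r y := by simp [l, r]
      rw [e1]
      simp only [map_add, add_apply, ContinuousLinearMap.bilinearComp_apply]
      ring
    have hid : Integrable (fun y : E => y) γ := IsGaussian.integrable_id
    have i1 : Integrable (fun y => Q.bilinearComp l r x y) γ :=
      (Q.bilinearComp l r x).integrable_comp hid
    have i2 : Integrable (fun y => Q.bilinearComp r l y x) γ :=
      ((Q.bilinearComp r l).flip x).integrable_comp hid
    have z1 : ∫ y, Q.bilinearComp l r x y ∂γ = 0 := by
      rw [ContinuousLinearMap.integral_comp_comm _ hid, integral_id_stdGaussian, map_zero]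
    have z2 : ∫ y, Q.bilinearComp r l y x ∂γ = 0 := by
      have := ContinuousLinearMap.integral_comp_comm ((Q.bilinearComp r l).flip x) hid
      rw [integral_id_stdGaussian, map_zero] at this
      exact this
    have i12 : Integrable (fun y => Q.bilinearComp l r x y + Q.bilinearComp r l y x) γ :=
      i1.add i2
    have i3 : Integrable (fun y => Q.bilinearComp l l x x
        + (Q.bilinearComp l r x y + Q.bilinearComp r l y x)) γ := (integrable_const _).add i12
    simp_rw [h1]
    rw [integral_add i3 (integrable_bilin _), integral_add (integrable_const _) i12,
      integral_add i1 i2, z1, z2,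
      integral_bilin_stdGaussian e]
    simp [r]
  simp_rw [inner_int]
  rw [integral_add (integrable_bilin _) (integrable_const _), integral_bilin_stdGaussian e,
    Finset.sum_add_distrib]
  simp [l]

end Trace

section Scalar

/-- The quadratic form that governs the Hessian of `H ^ R * z ^ (-m)` is nonnegative. -/
lemma quadratic_form_nonneg {a b ρ α β R c K h₁₁ h₁₂ h₂₂ : ℝ} (hα : α = a + b * ρ)
    (hβ : β = b + a * ρ) (hρ : 1 - a ^ 2 - b ^ 2 = 2 * a * b * ρ)
    (hPDI : 0 ≤ a ^ 2 * h₁₁ + 2 * a * b * ρ * h₁₂ + b ^ 2 * h₂₂)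
    (hk₁ : |h₁₁ * a * β + ρ * h₁₂ * (b * β - a * α) - h₂₂ * b * α| ≤ K)
    (hk₂ : |h₁₁ * β ^ 2 - 2 * ρ * h₁₂ * α * β + h₂₂ * α ^ 2| ≤ K)
    (hc : 2 * K ^ 2 ≤ c * (1 - ρ ^ 2)) (hc0 : 0 < c) (hR : c + 1 < R)
    (hρ1 : 0 < 1 - ρ ^ 2) (hRK : K + (1 - ρ ^ 2) ≤ R * (1 - ρ ^ 2) / 2) (s₁ s₂ s₃ : ℝ) :
    0 ≤ (R - 1) * (s₁ ^ 2 + s₂ ^ 2 + 2 * ρ * s₁ * s₂)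
      + (h₁₁ * s₁ ^ 2 + 2 * ρ * h₁₂ * s₁ * s₂ + h₂₂ * s₂ ^ 2)
      - 2 * (R - c - 1) * (α * s₁ + β * s₂) * s₃
      + (R - c - 1) * (R - c) / R * s₃ ^ 2 := by
  obtain ⟨N, rfl⟩ : ∃ N, R = N + c := ⟨R - c, by ring⟩
  have hN : 1 < N := by linarith
  have hN0 : 0 < N := by linarith
  set τ := α * s₁ + β * s₂ with hτ
  set σ := b * s₁ - a * s₂ with hσ
  set k₁ := h₁₁ * a * β + ρ * h₁₂ * (b * β - a * α) - h₂₂ * b * α with hk₁'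
  set k₂ := h₁₁ * β ^ 2 - 2 * ρ * h₁₂ * α * β + h₂₂ * α ^ 2 with hk₂'
  have hab : a * α + b * β = 1 := by rw [hα, hβ]; linarith
  have e₁ : s₁ = τ * a + σ * β := by
    rw [hτ, hσ]; linear_combination (-s₁) * hab
  have e₂ : s₂ = τ * b - σ * α := by
    rw [hτ, hσ]; linear_combination (-s₂) * hab
  have hform : h₁₁ * s₁ ^ 2 + 2 * ρ * h₁₂ * s₁ * s₂ + h₂₂ * s₂ ^ 2 =
      τ ^ 2 * (a ^ 2 * h₁₁ + 2 * a * b * ρ * h₁₂ + b ^ 2 * h₂₂) + 2 * (τ * σ) * k₁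
        + σ ^ 2 * k₂ := by
    rw [hk₁', hk₂', e₁, e₂]; ring
  have hsq : s₁ ^ 2 + s₂ ^ 2 + 2 * ρ * s₁ * s₂ = τ ^ 2 + (1 - ρ ^ 2) * σ ^ 2 := by
    rw [hτ, hσ, hα, hβ]
    linear_combination (s₁ ^ 2 + s₂ ^ 2 + 2 * ρ * s₁ * s₂) * hρ
  have hcomplete : (N + c - 1) * τ ^ 2 - 2 * (N - 1) * τ * s₃
      + (N - 1) * N / (N + c) * s₃ ^ 2 =
      (N - 1) * N / (N + c) * (s₃ - (N + c) * τ / N) ^ 2 + c / N * τ ^ 2 := by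
    have : N + c ≠ 0 := by positivity
    field_simp
    ring
  have h1 : 0 ≤ (N - 1) * N / (N + c) * (s₃ - (N + c) * τ / N) ^ 2 := by
    have : 0 ≤ N - 1 := by linarith
    positivity
  have h2 : -(K * |τ * σ|) ≤ (τ * σ) * k₁ := by
    have := abs_mul (τ * σ) k₁
    have h3 : |τ * σ| * |k₁| ≤ |τ * σ| * K := by gcongr
    linarith [neg_abs_le ((τ * σ) * k₁)]
  have h3 : -(K * σ ^ 2) ≤ σ ^ 2 * k₂ := by
    linarith [mul_le_mul_of_nonneg_left (neg_le_of_abs_le hk₂) (sq_nonneg σ)]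
  have hT : (1 - ρ ^ 2) * N / 2 ≤ (N + c - 1) * (1 - ρ ^ 2) - K := by
    have := mul_pos hc0 hρ1
    linarith
  have h4 : 2 * (K * |τ * σ|) ≤ c / N * τ ^ 2 + (1 - ρ ^ 2) * N / 2 * σ ^ 2 := by
    have hK0 : 0 ≤ K := (abs_nonneg _).trans hk₁
    have e : c / N * τ ^ 2 + (1 - ρ ^ 2) * N / 2 * σ ^ 2 - 2 * (K * |τ * σ|) =
        (1 / (c * N)) * ((c * |τ| - K * N * |σ|) ^ 2
          + N ^ 2 * |σ| ^ 2 * (c * (1 - ρ ^ 2) / 2 - K ^ 2)) := by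
      rw [abs_mul, ← sq_abs τ, ← sq_abs σ]
      field_simp
      ring
    have : 0 ≤ c * (1 - ρ ^ 2) / 2 - K ^ 2 := by linarith
    have : 0 ≤ (1 / (c * N)) * ((c * |τ| - K * N * |σ|) ^ 2
          + N ^ 2 * |σ| ^ 2 * (c * (1 - ρ ^ 2) / 2 - K ^ 2)) := by positivity
    linarith
  have h5 : 0 ≤ τ ^ 2 * (a ^ 2 * h₁₁ + 2 * a * b * ρ * h₁₂ + b ^ 2 * h₂₂) := by positivity
  have h6 := mul_le_mul_of_nonneg_right hT (sq_nonneg σ)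
  rw [hsq, hform]
  have e3 : N + c - c = N := by ring
  rw [e3]
  clear_value τ σ k₁ k₂
  linarith

end Scalar

section Hessian

/-- First and second derivatives along a line. -/
lemma hasDerivAt_line {W : Type*} [NormedAddCommGroup W] [NormedSpace ℝ W] {f : W → ℝ}
    {U : Set W} (hU : IsOpen U) (hf : ContDiffOn ℝ 2 f U) {w : W} (hw : w ∈ U) (η : W) :
    (∀ᶠ t : ℝ in 𝓝 0, w + t • η ∈ U ∧
      HasDerivAt (fun t : ℝ => f (w + t • η)) (fderiv ℝ f (w + t • η) η) t) ∧
    HasDerivAt (fun t : ℝ => fderiv ℝ f (w + t • η) η) (fderiv ℝ (fderiv ℝ f) w η η) 0 := by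
  have hl : ∀ t : ℝ, HasDerivAt (fun t : ℝ => w + t • η) η t := fun t => by
    simpa using ((hasDerivAt_id t).smul_const η).const_add w
  have hc : Tendsto (fun t : ℝ => w + t • η) (𝓝 0) (𝓝 w) := by
    have := (hl 0).continuousAt.tendsto
    simpa using this
  refine ⟨?_, ?_⟩
  · filter_upwards [hc.eventually (hU.mem_nhds hw)] with t ht
    refine ⟨ht, ?_⟩
    have hd := ((hf.differentiableOn (by norm_num)).differentiableAt
      (hU.mem_nhds ht)).hasFDerivAt
    exact hd.comp_hasDerivAt t (hl t)
  · have h1 : ContDiffOn ℝ 1 (fderiv ℝ f) U := hf.fderiv_of_isOpen hU (by norm_num)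
    have hd := ((h1.differentiableOn (by norm_num)).differentiableAt
      (hU.mem_nhds hw)).hasFDerivAt
    have hd' : HasFDerivAt (fderiv ℝ f) (fderiv ℝ (fderiv ℝ f) w) (w + (0 : ℝ) • η) := by
      simpa using hd
    have h2 : HasDerivAt (fun t : ℝ => fderiv ℝ f (w + t • η))
        (fderiv ℝ (fderiv ℝ f) w η) 0 := hd'.comp_hasDerivAt (0 : ℝ) (hl 0)
    exact ((ContinuousLinearMap.apply ℝ ℝ η).hasFDerivAt.comp_hasDerivAt (0 : ℝ) h2)

/-- The function `(x, z) ↦ H(x) ^ R * z ^ (-m)`. -/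
def powDiv (H : ℝ × ℝ → ℝ) (R m : ℝ) (w : (ℝ × ℝ) × ℝ) : ℝ := H w.1 ^ R * w.2 ^ (-m)

variable {H : ℝ × ℝ → ℝ} {U : Set (ℝ × ℝ)}

lemma contDiffOn_powDiv (hH : ContDiffOn ℝ 3 H U) (hpos : ∀ z ∈ U, 0 < H z) (R m : ℝ) :
    ContDiffOn ℝ 3 (powDiv H R m) (U ×ˢ Set.Ioi 0) := by
  refine ContDiffOn.mul ?_ ?_
  · have h : ContDiffOn ℝ 3 (fun w : (ℝ × ℝ) × ℝ => H w.1) (U ×ˢ Set.Ioi 0) :=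
      hH.comp contDiff_fst.contDiffOn fun w hw => hw.1
    exact h.rpow_const_of_ne fun w hw => (hpos _ hw.1).ne'
  · exact contDiff_snd.contDiffOn.rpow_const_of_ne fun w hw => ne_of_gt hw.2

lemma fderiv_fderiv_powDiv (hU : IsOpen U) (hH : ContDiffOn ℝ 3 H U)
    (hpos : ∀ z ∈ U, 0 < H z) {R m : ℝ} (hR : 0 < R) {w : (ℝ × ℝ) × ℝ} (hw : w.1 ∈ U)
    (hw2 : 0 < w.2) (η : (ℝ × ℝ) × ℝ) :
    fderiv ℝ (fderiv ℝ (powDiv H R m)) w η η = R * powDiv H R m w *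
      ((R - 1) * (fderiv ℝ H w.1 η.1 / H w.1) ^ 2
        + fderiv ℝ (fderiv ℝ H) w.1 η.1 η.1 / H w.1
        - 2 * m * (fderiv ℝ H w.1 η.1 / H w.1) * (η.2 / w.2)
        + m * (m + 1) / R * (η.2 / w.2) ^ 2) := by
  set B := powDiv H R m with hBdef
  obtain ⟨hB1, hB2⟩ := hasDerivAt_line (hU.prod isOpen_Ioi)
    ((contDiffOn_powDiv hH hpos R m).of_le (by norm_num)) (w := w) ⟨hw, hw2⟩ η
  obtain ⟨hH1, hH2⟩ := hasDerivAt_line hU (hH.of_le (by norm_num)) hw η.1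
  have hz : ∀ t : ℝ, HasDerivAt (fun t : ℝ => w.2 + t * η.2) η.2 t := fun t => by
    simpa using ((hasDerivAt_id t).mul_const η.2).const_add w.2
  have hlog : ∀ᶠ t : ℝ in 𝓝 0, fderiv ℝ B (w + t • η) η =
      B (w + t • η) * (R * (fderiv ℝ H (w.1 + t • η.1) η.1 / H (w.1 + t • η.1))
        - m * (η.2 / (w.2 + t * η.2))) := by
    filter_upwards [hB1, hH1] with t ht ht'
    have hHt : 0 < H (w.1 + t • η.1) := hpos _ ht'.1
    have hzt : 0 < w.2 + t * η.2 := ht.1.2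
    have hd := (ht'.2.rpow_const (p := R) (Or.inl hHt.ne')).mul
      ((hz t).rpow_const (p := -m) (Or.inl hzt.ne'))
    rw [ht.2.unique hd, rpow_sub_one hHt.ne', rpow_sub_one hzt.ne']
    simp only [hBdef, powDiv, Prod.fst_add, Prod.snd_add, Prod.smul_fst, Prod.smul_snd,
      smul_eq_mul]
    field_simp
    ring
  have hB0 : HasDerivAt (fun t : ℝ => B (w + t • η)) (fderiv ℝ B w η) 0 := by
    simpa using hB1.self_of_nhds.2
  have hH0 : HasDerivAt (fun t : ℝ => H (w.1 + t • η.1)) (fderiv ℝ H w.1 η.1) 0 := by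
    simpa using hH1.self_of_nhds.2
  have hHw : H w.1 ≠ 0 := (hpos _ hw).ne'
  have hd := hB0.mul ((((hH2.div hH0 (by simpa using hHw)).const_mul R).sub
    (((hasDerivAt_const (0 : ℝ) η.2).div (hz 0) (by simpa using hw2.ne')).const_mul m)))
  have hfin := (hd.congr_of_eventuallyEq hlog).unique hB2
  have h0 := hlog.self_of_nhds
  rw [← hfin]
  simp only [zero_smul, add_zero, zero_mul, Pi.sub_apply, Pi.div_apply] at h0 ⊢
  rw [h0]
  field_simp
  ring

end Hessian

section Nice

variable {E : Type*} [NormedAddCommGroup E] [InnerProductSpace ℝ E]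

/-- `ρ`, `α`, `β` are the inner products of the unit vectors `u₁`, `u₂`, `u₃` of the plane. -/
structure IsUnitGram (u₁ u₂ u₃ : ℝ × ℝ) (ρ α β : ℝ) : Prop where
  unit₁ : u₁.1 ^ 2 + u₁.2 ^ 2 = 1
  unit₂ : u₂.1 ^ 2 + u₂.2 ^ 2 = 1
  unit₃ : u₃.1 ^ 2 + u₃.2 ^ 2 = 1
  inner₁₂ : u₁.1 * u₂.1 + u₁.2 * u₂.2 = ρ
  inner₁₃ : u₁.1 * u₃.1 + u₁.2 * u₃.2 = α
  inner₂₃ : u₂.1 * u₃.1 + u₂.2 * u₃.2 = β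

variable (E) in
/-- The linear map `(x, y) ↦ u.1 • x + u.2 • y`. -/
def comb (u : ℝ × ℝ) : E × E →L[ℝ] E :=
  u.1 • ContinuousLinearMap.fst ℝ E E + u.2 • ContinuousLinearMap.snd ℝ E E

@[simp] lemma comb_apply (u : ℝ × ℝ) (ζ : E × E) : comb E u ζ = u.1 • ζ.1 + u.2 • ζ.2 := by
  simp [comb]

variable (E) in
/-- Linear maps whose `i`-th component factors through `comb E uᵢ`. -/
def factoring (u₁ u₂ u₃ : ℝ × ℝ) : Set (E × E →L[ℝ] (ℝ × ℝ) × ℝ) :=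
  {A | ∀ x : E, (A (x, 0)).1.1 * u₁.2 = (A (0, x)).1.1 * u₁.1 ∧
    (A (x, 0)).1.2 * u₂.2 = (A (0, x)).1.2 * u₂.1 ∧
    (A (x, 0)).2 * u₃.2 = (A (0, x)).2 * u₃.1}

variable {u₁ u₂ u₃ : ℝ × ℝ}

lemma isClosed_factoring : IsClosed (factoring E u₁ u₂ u₃) := by
  simp only [factoring, Set.ofPred_forall, Set.ofPred_and]
  refine isClosed_iInter fun x => ?_
  refine IsClosed.inter ?_ (IsClosed.inter ?_ ?_)
  all_goals exact isClosed_eq (by fun_prop) (by fun_prop)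

lemma convex_factoring : Convex ℝ (factoring E u₁ u₂ u₃) := by
  intro A hA B hB s t _ _ _ x
  obtain ⟨a₁, a₂, a₃⟩ := hA x
  obtain ⟨b₁, b₂, b₃⟩ := hB x
  simp only [add_apply, smul_apply, Prod.fst_add, Prod.snd_add, Prod.smul_fst, Prod.smul_snd,
    smul_eq_mul]
  refine ⟨?_, ?_, ?_⟩
  · linear_combination s * a₁ + t * b₁
  · linear_combination s * a₂ + t * b₂
  · linear_combination s * a₃ + t * b₃

lemma comb_mem_factoring (A₁ A₂ A₃ : E →L[ℝ] ℝ) :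
    ((A₁.comp (comb E u₁)).prod (A₂.comp (comb E u₂))).prod (A₃.comp (comb E u₃)) ∈
      factoring E u₁ u₂ u₃ := by
  intro x
  simp only [ContinuousLinearMap.prod_apply, ContinuousLinearMap.comp_apply, comb_apply, smul_zero,
    add_zero, zero_add, map_smul, smul_eq_mul]
  refine ⟨by ring, by ring, by ring⟩

variable {H : ℝ × ℝ → ℝ} {U : Set (ℝ × ℝ)}

lemma fderiv_apply_eq (H : ℝ × ℝ → ℝ) (z η : ℝ × ℝ) :
    fderiv ℝ H z η = η.1 * Hx H z + η.2 * Hy H z := by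
  have : η = η.1 • (1, 0) + η.2 • (0, 1) := by ext <;> simp
  conv_lhs => rw [this, map_add, map_smul, map_smul]
  rfl

lemma second_partials_eq {z : ℝ × ℝ} (hd : DifferentiableAt ℝ (fderiv ℝ H) z) :
    Hxx H z = fderiv ℝ (fderiv ℝ H) z (1, 0) (1, 0) ∧
      Hxy H z = fderiv ℝ (fderiv ℝ H) z (0, 1) (1, 0) ∧
      Hyy H z = fderiv ℝ (fderiv ℝ H) z (0, 1) (0, 1) := by
  have key : ∀ u v : ℝ × ℝ, fderiv ℝ (fun z => fderiv ℝ H z u) z v =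
      fderiv ℝ (fderiv ℝ H) z v u := by
    intro u v
    have := ((ContinuousLinearMap.apply ℝ ℝ u).hasFDerivAt.comp z hd.hasFDerivAt).fderiv
    exact congrArg (fun A => A v) this
  exact ⟨key (1, 0) (1, 0), key (1, 0) (0, 1), key (0, 1) (0, 1)⟩

lemma fderiv_fderiv_apply_eq (hU : IsOpen U) (hH : ContDiffOn ℝ 3 H U) {z : ℝ × ℝ} (hz : z ∈ U)
    (η : ℝ × ℝ) : fderiv ℝ (fderiv ℝ H) z η η =
      η.1 ^ 2 * Hxx H z + 2 * η.1 * η.2 * Hxy H z + η.2 ^ 2 * Hyy H z := by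
  have h1 : ContDiffOn ℝ 2 (fderiv ℝ H) U := hH.fderiv_of_isOpen hU (by norm_num)
  obtain ⟨exx, exy, eyy⟩ := second_partials_eq
    ((h1.differentiableOn (by norm_num)).differentiableAt (hU.mem_nhds hz))
  have sym := ((hH.contDiffAt (hU.mem_nhds hz)).isSymmSndFDerivAt (by simp; norm_num))
    (1, 0) (0, 1)
  have : η = η.1 • (1, 0) + η.2 • (0, 1) := by ext <;> simp
  conv_lhs => rw [this]
  simp only [map_add, map_smul, add_apply, smul_apply, smul_eq_mul]
  rw [exx, exy, eyy, sym]
  ring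

/-- The quadratic form of the Hessian of `powDiv H R m` in logarithmic coordinates, corrected by
the Gram matrix of three unit vectors, is nonnegative. -/
def FormNonneg (H : ℝ × ℝ → ℝ) (U : Set (ℝ × ℝ)) (ρ α β R m : ℝ) : Prop :=
  ∀ z ∈ U, ∀ s₁ s₂ s₃ : ℝ, 0 ≤ (R - 1) * (s₁ ^ 2 + s₂ ^ 2 + 2 * ρ * s₁ * s₂)
      + (H z * Hxx H z / Hx H z ^ 2 * s₁ ^ 2
        + 2 * ρ * (H z * Hxy H z / (Hx H z * Hy H z)) * s₁ * s₂
        + H z * Hyy H z / Hy H z ^ 2 * s₂ ^ 2)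
      - 2 * m * (α * s₁ + β * s₂) * s₃ + m * (m + 1) / R * s₃ ^ 2

lemma hessian_add_hessian_nonneg (hU : IsOpen U) (hH : ContDiffOn ℝ 3 H U)
    (hpos : ∀ z ∈ U, 0 < H z) (hx : ∀ z ∈ U, Hx H z ≠ 0) (hy : ∀ z ∈ U, Hy H z ≠ 0)
    {ρ α β R m : ℝ} (hR : 0 < R) (hu : IsUnitGram u₁ u₂ u₃ ρ α β)
    (hQ : FormNonneg H U ρ α β R m) {w : (ℝ × ℝ) × ℝ} (hw : w ∈ U ×ˢ Set.Ioi (0 : ℝ))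
    {ξ ξ' : (ℝ × ℝ) × ℝ} (h₁ : ξ.1.1 * u₁.2 = ξ'.1.1 * u₁.1)
    (h₂ : ξ.1.2 * u₂.2 = ξ'.1.2 * u₂.1) (h₃ : ξ.2 * u₃.2 = ξ'.2 * u₃.1) :
    0 ≤ fderiv ℝ (fderiv ℝ (powDiv H R m)) w ξ ξ
      + fderiv ℝ (fderiv ℝ (powDiv H R m)) w ξ' ξ' := by
  obtain ⟨hw1, hw2 : 0 < w.2⟩ := hw
  obtain ⟨⟨ξ₁, ξ₂⟩, ξ₃⟩ := ξ
  obtain ⟨⟨ξ₁', ξ₂'⟩, ξ₃'⟩ := ξ'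
  simp only at h₁ h₂ h₃
  obtain ⟨σ₁, e₁, e₁'⟩ : ∃ σ, ξ₁ = u₁.1 * σ ∧ ξ₁' = u₁.2 * σ :=
    ⟨u₁.1 * ξ₁ + u₁.2 * ξ₁', by linear_combination (-ξ₁) * hu.unit₁ + u₁.2 * h₁,
      by linear_combination (-ξ₁') * hu.unit₁ - u₁.1 * h₁⟩
  obtain ⟨σ₂, e₂, e₂'⟩ : ∃ σ, ξ₂ = u₂.1 * σ ∧ ξ₂' = u₂.2 * σ :=
    ⟨u₂.1 * ξ₂ + u₂.2 * ξ₂', by linear_combination (-ξ₂) * hu.unit₂ + u₂.2 * h₂,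
      by linear_combination (-ξ₂') * hu.unit₂ - u₂.1 * h₂⟩
  obtain ⟨σ₃, e₃, e₃'⟩ : ∃ σ, ξ₃ = u₃.1 * σ ∧ ξ₃' = u₃.2 * σ :=
    ⟨u₃.1 * ξ₃ + u₃.2 * ξ₃', by linear_combination (-ξ₃) * hu.unit₃ + u₃.2 * h₃,
      by linear_combination (-ξ₃') * hu.unit₃ - u₃.1 * h₃⟩
  have hHw := hpos _ hw1
  have hxw := hx _ hw1
  have hyw := hy _ hw1
  have hB : 0 < powDiv H R m w := mul_pos (rpow_pos_of_pos hHw _) (rpow_pos_of_pos hw2 _)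
  rw [fderiv_fderiv_powDiv hU hH hpos hR hw1 hw2, fderiv_fderiv_powDiv hU hH hpos hR hw1 hw2,
    ← mul_add]
  refine mul_nonneg (by positivity) ((hQ _ hw1 (Hx H w.1 * σ₁ / H w.1) (Hy H w.1 * σ₂ / H w.1)
    (σ₃ / w.2)).trans (le_of_eq ?_))
  simp only [fderiv_apply_eq, fderiv_fderiv_apply_eq hU hH hw1]
  obtain ⟨c₁, c₂, c₃, c₁₂, c₁₃, c₂₃⟩ := hu
  subst e₁ e₁' e₂ e₂' e₃ e₃'
  rw [← c₁₂, ← c₁₃, ← c₂₃]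
  set S₁ := Hx H w.1 * σ₁ / H w.1 with hS₁
  set S₂ := Hy H w.1 * σ₂ / H w.1 with hS₂
  set S₃ := σ₃ / w.2 with hS₃
  have k1 : ∀ s t : ℝ, (s * σ₁ * Hx H w.1 + t * σ₂ * Hy H w.1) / H w.1 = s * S₁ + t * S₂ := by
    intro s t; rw [hS₁, hS₂]; ring
  have k3 : ∀ s : ℝ, s * σ₃ / w.2 = s * S₃ := by
    intro s; rw [hS₃]; ring
  have k2 : ∀ s t : ℝ, ((s * σ₁) ^ 2 * Hxx H w.1 + 2 * (s * σ₁) * (t * σ₂) * Hxy H w.1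
      + (t * σ₂) ^ 2 * Hyy H w.1) / H w.1 = H w.1 * Hxx H w.1 / Hx H w.1 ^ 2 * (s * S₁) ^ 2
        + 2 * (H w.1 * Hxy H w.1 / (Hx H w.1 * Hy H w.1)) * (s * S₁) * (t * S₂)
        + H w.1 * Hyy H w.1 / Hy H w.1 ^ 2 * (t * S₂) ^ 2 := by
    intro s t; rw [hS₁, hS₂]; field_simp
  simp only [k1, k2, k3]
  clear_value S₁ S₂ S₃
  generalize H w.1 * Hxx H w.1 / Hx H w.1 ^ 2 = A
  generalize H w.1 * Hxy H w.1 / (Hx H w.1 * Hy H w.1) = B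
  generalize H w.1 * Hyy H w.1 / Hy H w.1 ^ 2 = C
  generalize m * (m + 1) / R = D
  linear_combination (-((R - 1) * S₁ ^ 2 + A * S₁ ^ 2)) * c₁
    - ((R - 1) * S₂ ^ 2 + C * S₂ ^ 2) * c₂ - D * S₃ ^ 2 * c₃

variable [FiniteDimensional ℝ E] [MeasurableSpace E] [BorelSpace E]

lemma exists_hessianNonneg_powDiv (hU : IsOpen U) (hH : ContDiffOn ℝ 3 H U)
    (hpos : ∀ z ∈ U, 0 < H z) (hx : ∀ z ∈ U, Hx H z ≠ 0) (hy : ∀ z ∈ U, Hy H z ≠ 0)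
    {ρ α β R m : ℝ} (hR : 0 < R) (hu : IsUnitGram u₁ u₂ u₃ ρ α β)
    (hQ : FormNonneg H U ρ α β R m) {K : Set ((ℝ × ℝ) × ℝ)} (hK : IsCompact K)
    (hKc : Convex ℝ K) (hKU : K ⊆ U ×ˢ Set.Ioi 0) :
    ∃ M, 0 ≤ M ∧ HessianNonneg
      ((ProbabilityTheory.stdGaussian E).prod (ProbabilityTheory.stdGaussian E)) K
      (factoring E u₁ u₂ u₃) M (powDiv H R m) (fderiv ℝ (powDiv H R m))
      (fderiv ℝ (fderiv ℝ (powDiv H R m))) := by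
  have hB := contDiffOn_powDiv hH hpos R m
  obtain ⟨M, hM, h2, hd, ht⟩ := exists_taylor_bound (hU.prod isOpen_Ioi) hKU hK hKc hB
  refine ⟨M, hM, ⟨hB.continuousOn.mono hKU, h2, hd, ht, fun w hw A hA => ?_⟩⟩
  set D := fderiv ℝ (fderiv ℝ (powDiv H R m)) w with hD
  have := integral_bilin_prod_stdGaussian (stdOrthonormalBasis ℝ E) (D.bilinearComp A A)
  simp only [ContinuousLinearMap.bilinearComp_apply] at this
  rw [this]
  refine Finset.sum_nonneg fun i _ => ?_
  obtain ⟨h₁, h₂, h₃⟩ := hA (stdOrthonormalBasis ℝ E i)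
  exact hessian_add_hessian_nonneg hU hH hpos hx hy hR hu hQ (hKU hw) h₁ h₂ h₃

end Nice

section Approximation

variable {E : Type*} [NormedAddCommGroup E] [InnerProductSpace ℝ E]

/-- A `C²` function with values in `[l, u]` that is constant outside a compact set. -/
structure NiceInto (f : E → ℝ) (l u : ℝ) : Prop where
  contDiff : ContDiff ℝ 2 f
  compact : ∃ c, HasCompactSupport fun x => f x - c
  mem : ∀ x, f x ∈ Set.Icc l u

lemma norm_taylor_le {X : Type*} [NormedAddCommGroup X] [NormedSpace ℝ X] {f : X → ℝ}
    (hf : ContDiff ℝ 2 f) {C : ℝ} (hC : ∀ z, ‖fderiv ℝ (fderiv ℝ f) z‖ ≤ C) (x k : X) :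
    ‖f (x + k) - f x - fderiv ℝ f x k‖ ≤ C * ‖k‖ ^ 2 := by
  have h1 : ContDiff ℝ 1 (fderiv ℝ f) := hf.fderiv_right (by norm_num)
  have hC0 : 0 ≤ C := (norm_nonneg (fderiv ℝ (fderiv ℝ f) 0)).trans (hC 0)
  have dF : ∀ x, HasFDerivAt f (fderiv ℝ f x) x := fun x =>
    (hf.differentiable (by norm_num) x).hasFDerivAt
  have dD : ∀ x, HasFDerivAt (fderiv ℝ f) (fderiv ℝ (fderiv ℝ f) x) x := fun x =>
    (h1.differentiable (by norm_num) x).hasFDerivAt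
  have lip : ∀ x y, ‖fderiv ℝ f y - fderiv ℝ f x‖ ≤ C * ‖y - x‖ := fun x y =>
    convex_univ.norm_image_sub_le_of_norm_hasFDerivWithin_le
      (fun z _ => (dD z).hasFDerivWithinAt) (fun z _ => hC z) (Set.mem_univ x) (Set.mem_univ y)
  have := (convex_segment (𝕜 := ℝ) x (x + k)).norm_image_sub_le_of_norm_hasFDerivWithin_le
    (f := fun y => f y - fderiv ℝ f x y) (f' := fun y => fderiv ℝ f y - fderiv ℝ f x)
    (C := C * ‖k‖)
    (fun y _ => ((dF y).sub (fderiv ℝ f x).hasFDerivAt).hasFDerivWithinAt)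
    (fun y hy => (lip x y).trans (mul_le_mul_of_nonneg_left
      (by simpa using norm_sub_le_of_mem_segment hy) hC0))
    (left_mem_segment ℝ x (x + k)) (right_mem_segment ℝ x (x + k))
  rw [add_sub_cancel_left] at this
  calc _ = ‖f (x + k) - fderiv ℝ f x (x + k) - (f x - fderiv ℝ f x x)‖ := by
          rw [map_add]; congr 1; ring
    _ ≤ _ := this
    _ = _ := by ring

lemma exists_norm_fderiv_le_of_hasCompactSupport {X Y : Type*} [NormedAddCommGroup X]
    [NormedSpace ℝ X] [NormedAddCommGroup Y] [NormedSpace ℝ Y] {f : X → Y}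
    (hs : HasCompactSupport f) (hf : ContDiff ℝ 1 f) : ∃ C, ∀ x, ‖fderiv ℝ f x‖ ≤ C :=
  (hs.fderiv ℝ).exists_bound_of_continuous (hf.continuous_fderiv (by norm_num))

lemma NiceInto.exists_norm_fderiv_le {f : E → ℝ} {l u : ℝ} (hf : NiceInto f l u) :
    ∃ C₁ C₂, (∀ x, ‖fderiv ℝ f x‖ ≤ C₁) ∧ ∀ x, ‖fderiv ℝ (fderiv ℝ f) x‖ ≤ C₂ := by
  obtain ⟨c, hc⟩ := hf.compact
  have hd : fderiv ℝ (fun x => f x - c) = fderiv ℝ f := by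
    ext1 x
    rw [fderiv_sub_const]
  have hs : HasCompactSupport (fderiv ℝ f) := by
    rw [← hd]
    exact hc.fderiv ℝ
  have h1 : ContDiff ℝ 1 (fderiv ℝ f) := hf.contDiff.fderiv_right (by norm_num)
  obtain ⟨C₁, hC₁⟩ := hs.exists_bound_of_continuous h1.continuous
  obtain ⟨C₂, hC₂⟩ := exists_norm_fderiv_le_of_hasCompactSupport hs h1
  exact ⟨C₁, C₂, hC₁, hC₂⟩

/-- First-order Taylor expansion with quadratic error for a `C²` function that is constant outside
a compact set. -/
lemma NiceInto.exists_taylor_bound {V : Type*} [NormedAddCommGroup V] [NormedSpace ℝ V]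
    {f : E → ℝ} {l u : ℝ} (hf : NiceInto f l u) (v : V →L[ℝ] E) :
    ∃ L, (∀ z, ‖(fderiv ℝ f (v z)).comp v‖ ≤ L) ∧
      ∀ z h, ‖f (v (z + h)) - f (v z) - (fderiv ℝ f (v z)).comp v h‖ ≤ L * ‖h‖ ^ 2 := by
  obtain ⟨C₁, C₂, hC₁, hC₂⟩ := hf.exists_norm_fderiv_le
  have hC₂0 : 0 ≤ C₂ := (norm_nonneg (fderiv ℝ (fderiv ℝ f) 0)).trans (hC₂ 0)
  refine ⟨max (C₁ * ‖v‖) (C₂ * ‖v‖ ^ 2), fun z => le_max_of_le_left ?_, fun z h => ?_⟩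
  · exact (ContinuousLinearMap.opNorm_comp_le _ _).trans (by gcongr; exact hC₁ _)
  · rw [map_add, ContinuousLinearMap.comp_apply]
    refine (norm_taylor_le hf.contDiff hC₂ (v z) (v h)).trans ?_
    have hv : ‖v h‖ ^ 2 ≤ (‖v‖ * ‖h‖) ^ 2 := by gcongr; exact v.le_opNorm h
    calc _ ≤ C₂ * (‖v‖ * ‖h‖) ^ 2 := by gcongr
      _ = C₂ * ‖v‖ ^ 2 * ‖h‖ ^ 2 := by ring
      _ ≤ _ := by gcongr; exact le_max_right _ _

variable {u₁ u₂ u₃ : ℝ × ℝ} [FiniteDimensional ℝ E]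

lemma exists_smoothInto {f g ψ : E → ℝ} {l₁ l₂ l₃ r₁ r₂ r₃ : ℝ} (hf : NiceInto f l₁ r₁)
    (hg : NiceInto g l₂ r₂) (hψ : NiceInto ψ l₃ r₃) :
    ∃ L G, SmoothInto ((Set.Icc l₁ r₁ ×ˢ Set.Icc l₂ r₂) ×ˢ Set.Icc l₃ r₃) (factoring E u₁ u₂ u₃) L
      (fun ζ : E × E => ((f (comb E u₁ ζ), g (comb E u₂ ζ)), ψ (comb E u₃ ζ))) G := by
  obtain ⟨L₁, b₁, t₁⟩ := hf.exists_taylor_bound (comb E u₁)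
  obtain ⟨L₂, b₂, t₂⟩ := hg.exists_taylor_bound (comb E u₂)
  obtain ⟨L₃, b₃, t₃⟩ := hψ.exists_taylor_bound (comb E u₃)
  have hcf := hf.contDiff.continuous
  have hcg := hg.contDiff.continuous
  have hcψ := hψ.contDiff.continuous
  have hdf := hf.contDiff.continuous_fderiv (by norm_num)
  have hdg := hg.contDiff.continuous_fderiv (by norm_num)
  have hdψ := hψ.contDiff.continuous_fderiv (by norm_num)
  have hle₁ : L₁ ≤ max (max L₁ L₂) L₃ := (le_max_left _ _).trans (le_max_left _ _)
  have hle₂ : L₂ ≤ max (max L₁ L₂) L₃ := (le_max_right _ _).trans (le_max_left _ _)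
  have hle₃ : L₃ ≤ max (max L₁ L₂) L₃ := le_max_right _ _
  refine ⟨max (max L₁ L₂) L₃, fun ζ =>
    (((fderiv ℝ f (comb E u₁ ζ)).comp (comb E u₁)).prod
      ((fderiv ℝ g (comb E u₂ ζ)).comp (comb E u₂))).prod
        ((fderiv ℝ ψ (comb E u₃ ζ)).comp (comb E u₃)), ?_, ?_, ?_, ?_, ?_, ?_⟩
  · exact fun ζ => ⟨⟨hf.mem _, hg.mem _⟩, hψ.mem _⟩
  · fun_prop
  · refine continuous_clm_apply.2 fun h => ?_
    simp only [ContinuousLinearMap.prod_apply, ContinuousLinearMap.comp_apply]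
    fun_prop
  · exact fun ζ => comb_mem_factoring _ _ _
  · intro ζ
    rw [ContinuousLinearMap.opNorm_prod, norm_prod_le_iff, ContinuousLinearMap.opNorm_prod,
      norm_prod_le_iff]
    exact ⟨⟨(b₁ ζ).trans hle₁, (b₂ ζ).trans hle₂⟩, (b₃ ζ).trans hle₃⟩
  · intro ζ h
    refine norm_prod_le_iff.2 ⟨norm_prod_le_iff.2 ⟨?_, ?_⟩, ?_⟩
    · exact (t₁ ζ h).trans (by gcongr)
    · exact (t₂ ζ h).trans (by gcongr)
    · exact (t₃ ζ h).trans (by gcongr)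

variable [MeasurableSpace E] [BorelSpace E]

open scoped Convolution in
/-- Bounded measurable functions are almost everywhere limits of nice functions whose values stay
strictly inside the given interval. -/
lemma exists_niceInto_tendsto (ν : Measure E) [ν.IsAddHaarMeasure] {f : E → ℝ} {l u : ℝ}
    (hf : Measurable f) (hlu : l < u) (hmem : ∀ x, f x ∈ Set.Icc l u) :
    ∃ (F : ℕ → E → ℝ) (l' u' : ℕ → ℝ), (∀ j, NiceInto (F j) (l' j) (u' j)) ∧
      (∀ j, l < l' j ∧ u' j < u) ∧ ∀ᵐ x ∂ν, Tendsto (fun j => F j x) atTop (𝓝 (f x)) := by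
  have hr : ∀ j : ℕ, (0 : ℝ) < 1 / (j + 1) := fun j => by positivity
  let φ : ℕ → ContDiffBump (0 : E) := fun j =>
    ⟨1 / (j + 1) / 2, 1 / (j + 1), by positivity, half_lt_self (hr j)⟩
  let χ : ℕ → ContDiffBump (0 : E) := fun j => ⟨j + 1, j + 2, by positivity, by linarith⟩
  set c := (l + u) / 2 with hc
  let θ : ℕ → ℝ := fun j => j / (j + 1)
  have hbd : ∀ x, ‖f x‖ ≤ max |l| |u| := fun x => by
    rw [Real.norm_eq_abs]
    exact abs_le_max_abs_abs (hmem x).1 (hmem x).2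
  have hloc : LocallyIntegrable f ν := by
    intro x
    obtain ⟨s, hxs, hs, hlt⟩ := ν.exists_isOpen_measure_lt_top x
    refine ⟨s, hs.mem_nhds hxs, ?_⟩
    exact Measure.integrableOn_of_bounded hlt.ne hf.aestronglyMeasurable
      (ae_of_all _ hbd)
  let g : ℕ → E → ℝ := fun j => (φ j).normed ν ⋆[ContinuousLinearMap.lsmul ℝ ℝ, ν] f
  have hg_diff : ∀ j, ContDiff ℝ 2 (g j) := fun j =>
    (φ j).hasCompactSupport_normed.contDiff_convolution_left _ (φ j).contDiff_normed hloc
  have hg_mem : ∀ j x, g j x ∈ Set.Icc l u := by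
    intro j x
    have hφi : Integrable ((φ j).normed ν) ν := (φ j).integrable_normed
    have hint : Integrable (fun t => (φ j).normed ν t * f (x - t)) ν :=
      hφi.mul_bdd (c := max |l| |u|)
        ((hf.comp (measurable_const.sub measurable_id)).aestronglyMeasurable)
        (ae_of_all _ fun t => hbd _)
    have hone : ∀ s : ℝ, ∫ t, (φ j).normed ν t * s ∂ν = s := fun s => by
      rw [integral_mul_const, (φ j).integral_normed, one_mul]
    have hval : g j x = ∫ t, (φ j).normed ν t * f (x - t) ∂ν := by
      simp [g, convolution_def]
    rw [hval]
    constructor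
    · rw [← hone l]
      exact integral_mono (hφi.mul_const l) hint fun t =>
        mul_le_mul_of_nonneg_left (hmem _).1 ((φ j).nonneg_normed t)
    · rw [← hone u]
      exact integral_mono hint (hφi.mul_const u) fun t =>
        mul_le_mul_of_nonneg_left (hmem _).2 ((φ j).nonneg_normed t)
  have hr0 : Tendsto (fun j : ℕ => (1 : ℝ) / (j + 1)) atTop (𝓝 0) :=
    tendsto_one_div_add_atTop_nhds_zero_nat
  have hθ : Tendsto θ atTop (𝓝 1) := tendsto_natCast_div_add_atTop 1
  refine ⟨fun j x => c + θ j * (χ j x * (g j x - c)), fun j => c - θ j * ((u - l) / 2),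
    fun j => c + θ j * ((u - l) / 2), fun j => ⟨?_, ⟨c, ?_⟩, fun x => ?_⟩, fun j => ?_, ?_⟩
  · exact contDiff_const.add (contDiff_const.mul
      ((χ j).contDiff.mul ((hg_diff j).sub contDiff_const)))
  · simp only [add_sub_cancel_left]
    exact ((χ j).hasCompactSupport.mul_right).mul_left
  · have h0 : 0 ≤ θ j := by positivity
    have h1 : |χ j x * (g j x - c)| ≤ (u - l) / 2 := by
      rw [abs_mul, abs_of_nonneg ((χ j).nonneg)]
      have h2 : |g j x - c| ≤ (u - l) / 2 := by
        rw [abs_le]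
        constructor <;> linarith [(hg_mem j x).1, (hg_mem j x).2]
      exact (mul_le_of_le_one_left (abs_nonneg _) (χ j).le_one).trans h2
    obtain ⟨h3, h4⟩ := abs_le.1 h1
    constructor <;> nlinarith
  · have h1 : θ j < 1 := by
      rw [div_lt_one (by positivity)]
      linarith
    constructor <;> nlinarith
  · have hconv := ContDiffBump.ae_convolution_tendsto_right_of_locallyIntegrable (μ := ν) (φ := φ)
      (K := 2) hr0 (Eventually.of_forall fun j => le_of_eq (by simp [φ]; ring)) hloc
    filter_upwards [hconv] with x hx
    have hχ : ∀ᶠ j : ℕ in atTop, χ j x = 1 := by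
      filter_upwards [eventually_ge_atTop ⌈‖x‖⌉₊] with j hj
      refine (χ j).one_of_mem_closedBall ?_
      rw [mem_closedBall_zero_iff]
      exact ((Nat.le_ceil _).trans (Nat.cast_le.2 hj)).trans (by simp [χ])
    have h1 : Tendsto (fun j => c + θ j * (g j x - c)) atTop (𝓝 (c + 1 * (f x - c))) :=
      tendsto_const_nhds.add (hθ.mul (hx.sub tendsto_const_nhds))
    rw [one_mul, add_sub_cancel] at h1
    refine h1.congr' ?_
    filter_upwards [hχ] with j hj
    rw [hj, one_mul]

end Approximation

section Limit

variable {V W : Type*} [MeasurableSpace V] [NormedAddCommGroup W] [NormedSpace ℝ W]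
  [FiniteDimensional ℝ W] [MeasurableSpace W] [BorelSpace W]

omit [NormedSpace ℝ W] [FiniteDimensional ℝ W] in
lemma measurable_comp_of_mem {K : Set W} (hK : IsCompact K)
    {B : W → ℝ} (hB : ContinuousOn B K) {F : V → W} (hF : Measurable F) (hFK : ∀ z, F z ∈ K) :
    Measurable fun z => B (F z) := by
  have h : Measurable (K.indicator B) := by
    classical
    rw [← Set.piecewise_eq_indicator]
    exact hB.measurable_piecewise continuousOn_const hK.measurableSet
  convert h.comp hF using 2 with z
  simp [Set.indicator_of_mem (hFK z)]

/-- Jensen-type inequalities on a compact convex set are stable under almost everywhere limits. -/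
lemma le_integral_comp_of_tendsto {μ : Measure V} [IsProbabilityMeasure μ] {K : Set W}
    (hK : IsCompact K) (hKc : Convex ℝ K) {B : W → ℝ} (hB : ContinuousOn B K) {Fj : ℕ → V → W}
    {F : V → W} (hFj : ∀ j, Measurable (Fj j)) (hF : Measurable F) (hFjK : ∀ j z, Fj j z ∈ K)
    (hFK : ∀ z, F z ∈ K) (hlim : ∀ᵐ z ∂μ, Tendsto (fun j => Fj j z) atTop (𝓝 (F z)))
    (h : ∀ j, B (∫ z, Fj j z ∂μ) ≤ ∫ z, B (Fj j z) ∂μ) :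
    B (∫ z, F z ∂μ) ≤ ∫ z, B (F z) ∂μ := by
  obtain ⟨C, hC⟩ := hK.isBounded.exists_norm_le
  obtain ⟨C', hC'⟩ := hK.exists_bound_of_continuousOn hB
  have hint : ∀ G : V → W, Measurable G → (∀ z, G z ∈ K) → (∫ z, G z ∂μ) ∈ K := fun G hG hGK =>
    hKc.integral_mem hK.isClosed (ae_of_all _ hGK)
      (Integrable.of_bound hG.aestronglyMeasurable C (ae_of_all _ fun z => hC _ (hGK z)))
  have h1 : Tendsto (fun j => ∫ z, Fj j z ∂μ) atTop (𝓝 (∫ z, F z ∂μ)) :=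
    tendsto_integral_of_dominated_convergence (fun _ => C)
      (fun j => (hFj j).aestronglyMeasurable) (integrable_const C)
      (fun j => ae_of_all _ fun z => hC _ (hFjK j z)) hlim
  have h2 : Tendsto (fun j => ∫ z, B (Fj j z) ∂μ) atTop (𝓝 (∫ z, B (F z) ∂μ)) := by
    refine tendsto_integral_of_dominated_convergence (fun _ => C')
      (fun j => (measurable_comp_of_mem hK hB (hFj j) (hFjK j)).aestronglyMeasurable)
      (integrable_const C') (fun j => ae_of_all _ fun z => hC' _ (hFjK j z)) ?_
    filter_upwards [hlim] with z hz
    exact (hB (F z) (hFK z)).tendsto.comp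
      (tendsto_nhdsWithin_iff.2 ⟨hz, Eventually.of_forall fun j => hFjK j z⟩)
  have h3 : Tendsto (fun j => B (∫ z, Fj j z ∂μ)) atTop (𝓝 (B (∫ z, F z ∂μ))) :=
    (hB _ (hint F hF hFK)).tendsto.comp
      (tendsto_nhdsWithin_iff.2 ⟨h1, Eventually.of_forall fun j => hint _ (hFj j) (hFjK j)⟩)
  exact le_of_tendsto_of_tendsto' h3 h2 h

end Limit

section Law

variable {E : Type*} [NormedAddCommGroup E] [InnerProductSpace ℝ E] [FiniteDimensional ℝ E]
  [MeasurableSpace E] [BorelSpace E]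

lemma integrable_exp_neg_sq_norm :
    Integrable fun x : E => Real.exp (-‖x‖ ^ 2 / 2) := by
  have h := (GaussianFourier.integrable_cexp_neg_mul_sq_norm_add (V := E) (b := 1 / 2)
    (by norm_num) 0 0).norm
  refine h.congr (ae_of_all _ fun x => ?_)
  simp only [Complex.norm_exp]
  congr 1
  have : (-(1 / 2 : ℂ) * (‖x‖ : ℂ) ^ 2 + 0 * (inner ℝ (0 : E) x : ℝ)) =
    ((-‖x‖ ^ 2 / 2 : ℝ) : ℂ) := by push_cast; ring
  rw [this, Complex.ofReal_re]

lemma stdGaussian_eq_withDensity :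
    ProbabilityTheory.stdGaussian E = volume.withDensity fun x => ENNReal.ofReal
      ((2 * π) ^ (-(Module.finrank ℝ E : ℝ) / 2) * Real.exp (-‖x‖ ^ 2 / 2)) := by
  set C : ℝ := (2 * π) ^ (-(Module.finrank ℝ E : ℝ) / 2) with hC
  have hC0 : 0 ≤ C := by positivity
  have hfin : IsFiniteMeasure (volume.withDensity fun x : E => ENNReal.ofReal
      (C * Real.exp (-‖x‖ ^ 2 / 2))) :=
    isFiniteMeasure_withDensity_ofReal (integrable_exp_neg_sq_norm.const_mul C).2
  refine Measure.ext_of_charFun ?_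
  ext t
  rw [ProbabilityTheory.charFun_stdGaussian, charFun_apply,
    integral_withDensity_eq_integral_toReal_smul (by fun_prop) (by simp)]
  have h1 : ∀ x : E, (ENNReal.ofReal (C * Real.exp (-‖x‖ ^ 2 / 2))).toReal •
      Complex.exp ((inner ℝ x t : ℝ) * Complex.I) =
      (C : ℂ) * Complex.exp (-(1 / 2 : ℂ) * (‖x‖ : ℂ) ^ 2 + Complex.I * (inner ℝ t x : ℝ)) := by
    intro x
    rw [ENNReal.toReal_ofReal (by positivity), Complex.real_smul, Complex.ofReal_mul, mul_assoc,
      Complex.ofReal_exp, ← Complex.exp_add, real_inner_comm]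
    congr 2
    push_cast
    ring
  simp_rw [h1]
  rw [integral_const_mul, GaussianFourier.integral_cexp_neg_mul_sq_norm_add (by norm_num),
    ← mul_assoc]
  have h2 : (C : ℂ) * ((π : ℂ) / (1 / 2)) ^ ((Module.finrank ℝ E : ℂ) / 2) = 1 := by
    have e : ((π : ℂ) / (1 / 2)) = ((2 * π : ℝ) : ℂ) := by push_cast; ring
    have e' : ((Module.finrank ℝ E : ℂ) / 2) = (((Module.finrank ℝ E : ℝ) / 2 : ℝ) : ℂ) := by
      push_cast; rfl
    rw [e, e', ← Complex.ofReal_cpow (by positivity), ← Complex.ofReal_mul, hC,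
      ← Real.rpow_add (by positivity)]
    rw [show -(Module.finrank ℝ E : ℝ) / 2 + (Module.finrank ℝ E : ℝ) / 2 = 0 by ring]
    simp
  rw [h2, one_mul]
  congr 1
  rw [Complex.I_sq]
  ring

lemma stdGaussian_absolutelyContinuous : ProbabilityTheory.stdGaussian E ≪ volume := by
  rw [stdGaussian_eq_withDensity]
  exact withDensity_absolutelyContinuous _ _

lemma map_comb_stdGaussian {u : ℝ × ℝ} (hu : u.1 ^ 2 + u.2 ^ 2 = 1) :
    ((ProbabilityTheory.stdGaussian E).prod (ProbabilityTheory.stdGaussian E)).map (comb E u) =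
      ProbabilityTheory.stdGaussian E := by
  have : SecondCountableTopology E := inferInstance
  obtain ⟨θ, h1, h2⟩ : ∃ θ, u.1 = Real.cos θ ∧ u.2 = Real.sin θ := by
    have hn : ‖(⟨u.1, u.2⟩ : ℂ)‖ = 1 := by
      rw [Complex.norm_eq_sqrt_sq_add_sq, hu, Real.sqrt_one]
    have h0 : (⟨u.1, u.2⟩ : ℂ) ≠ 0 := norm_ne_zero_iff.1 (by rw [hn]; norm_num)
    refine ⟨Complex.arg ⟨u.1, u.2⟩, ?_, ?_⟩
    · rw [Complex.cos_arg h0, hn, div_one]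
    · rw [Complex.sin_arg, hn, div_one]
  have hrot := ProbabilityTheory.IsGaussian.map_rotation_eq_self
    (μ := ProbabilityTheory.stdGaussian E) (by simp [ProbabilityTheory.integral_id_stdGaussian]) θ
  have hcomp : (comb E u : E × E → E) = Prod.fst ∘ ContinuousLinearMap.rotation θ := by
    ext1 ζ
    simp [ContinuousLinearMap.rotation_apply, h1, h2]
  rw [hcomp, ← Measure.map_map measurable_fst (by fun_prop), hrot]
  exact Measure.fst_prod

end Law

section Kernel

variable {n : ℕ}

lemma stdGaussian_eq : _root_.stdGaussian n = ProbabilityTheory.stdGaussian (Euc n) := by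
  rw [stdGaussian_eq_withDensity, finrank_euclideanSpace_fin]
  rfl

/-- `γ_{p,q,x}` is the law of `-(q/p) x + p^{-1/2} η` for a standard Gaussian vector `η`. -/
lemma integral_gammaPQX {p : ℝ} (hp : 0 < p) (q : ℝ) (x : Euc n) (F : Euc n → ℝ) :
    ∫ y, F y ∂(gammaPQX n p q x) =
      ∫ η, F ((-(q / p)) • x + (√p)⁻¹ • η) ∂(ProbabilityTheory.stdGaussian (Euc n)) := by
  have hs : 0 < √p := Real.sqrt_pos.2 hp
  rw [stdGaussian_eq_withDensity, finrank_euclideanSpace_fin, gammaPQX,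
    integral_withDensity_eq_integral_toReal_smul (by fun_prop) (by simp),
    integral_withDensity_eq_integral_toReal_smul (by fun_prop) (by simp)]
  set K : Euc n → ℝ := fun y => (ENNReal.ofReal ((p / (2 * π)) ^ ((n : ℝ) / 2) *
    Real.exp (-‖p • y + q • x‖ ^ 2 / (2 * p)))).toReal • F y with hK
  have h1 : ∫ y, K y = √p⁻¹ ^ n * ∫ η, K ((-(q / p)) • x + (√p)⁻¹ • η) := by
    rw [Measure.integral_comp_smul volume (fun y => K ((-(q / p)) • x + y)),
      integral_add_left_eq_self, finrank_euclideanSpace_fin, smul_eq_mul, ← mul_assoc,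
      abs_of_nonneg (by positivity), Real.sqrt_inv, mul_inv_cancel₀ (by positivity), one_mul]
  rw [h1, ← integral_const_mul]
  refine integral_congr_ae (ae_of_all _ fun η => ?_)
  have h2 : p • ((-(q / p)) • x + (√p)⁻¹ • η) + q • x = √p • η := by
    rw [smul_add, smul_smul, smul_smul, show p * -(q / p) = -q by field_simp,
      show p * (√p)⁻¹ = √p by rw [← div_eq_mul_inv, Real.div_sqrt]]
    module
  have h3 : ((p / (2 * π)) ^ ((n : ℝ) / 2)) * √p⁻¹ ^ n = (2 * π) ^ (-(n : ℝ) / 2) := by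
    rw [Real.sqrt_eq_rpow, ← Real.rpow_natCast, ← Real.rpow_mul (by positivity),
      show (1 : ℝ) / 2 * n = n / 2 by ring, ← Real.mul_rpow (by positivity) (by positivity),
      show p / (2 * π) * p⁻¹ = (2 * π)⁻¹ by field_simp, Real.inv_rpow (by positivity), neg_div,
      Real.rpow_neg (by positivity)]
  simp only [hK, h2]
  rw [ENNReal.toReal_ofReal (by positivity), ENNReal.toReal_ofReal (by positivity), norm_smul,
    Real.norm_of_nonneg hs.le, mul_pow, Real.sq_sqrt hp.le, ← h3, smul_eq_mul, smul_eq_mul,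
    show -(p * ‖η‖ ^ 2) / (2 * p) = -‖η‖ ^ 2 / 2 by field_simp]
  ring

end Kernel

/-- The vectors describing the change of variables behind `γ_{p,q,x}` have the expected Gram
matrix. -/
lemma isUnitGram_kernel {a b p q : ℝ} (ha : 0 < a) (hb : 0 < b)
    (hD : 0 < (1 - (a - b) ^ 2) * ((a + b) ^ 2 - 1))
    (hp : p = 4 / ((1 - (a - b) ^ 2) * ((a + b) ^ 2 - 1)))
    (hq : q = 2 * (a ^ 2 - b ^ 2 - 1) / ((1 - (a - b) ^ 2) * ((a + b) ^ 2 - 1))) :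
    IsUnitGram (a⁻¹ * (1 + q / p), -(a⁻¹ * (√p)⁻¹)) (-(b⁻¹ * (q / p)), b⁻¹ * (√p)⁻¹) (1, 0)
      ((1 - a ^ 2 - b ^ 2) / (2 * a * b)) (a + b * ((1 - a ^ 2 - b ^ 2) / (2 * a * b)))
      (b + a * ((1 - a ^ 2 - b ^ 2) / (2 * a * b))) := by
  have hpq : q / p = (a ^ 2 - b ^ 2 - 1) / 2 := by
    rw [hp, hq, div_div_div_cancel_right₀ hD.ne']
    ring
  have hp1 : ((√p)⁻¹) ^ 2 = (1 - (a - b) ^ 2) * ((a + b) ^ 2 - 1) / 4 := by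
    rw [inv_pow, Real.sq_sqrt (by rw [hp]; positivity), hp, inv_div]
  rw [hpq]
  set s := (√p)⁻¹
  constructor
  · simp only [neg_sq, mul_pow, hp1]
    field_simp
    ring
  · simp only [neg_sq, mul_pow, hp1]
    field_simp
    ring
  · simp
  · have : -(a⁻¹ * s) * (b⁻¹ * s) = -(a⁻¹ * b⁻¹ * s ^ 2) := by ring
    simp only [this, hp1]
    field_simp
    ring
  · field_simp
    ring
  · field_simp
    ring

section ThreeFunctions

variable {E : Type*} [NormedAddCommGroup E] [InnerProductSpace ℝ E] [FiniteDimensional ℝ E]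
  [MeasurableSpace E] [BorelSpace E]

lemma integral_stdGaussian_prod :
    ∫ ζ, ζ ∂((ProbabilityTheory.stdGaussian E).prod (ProbabilityTheory.stdGaussian E)) = 0 := by
  have hid : Integrable (fun x : E => x) (ProbabilityTheory.stdGaussian E) :=
    ProbabilityTheory.IsGaussian.integrable_id
  refine (integral_pair (hid.comp_fst _) (hid.comp_snd _)).trans ?_
  rw [integral_fun_fst (fun x : E => x), integral_fun_snd (fun x : E => x)]
  simp [ProbabilityTheory.integral_id_stdGaussian]

lemma integral_comp_comb {u : ℝ × ℝ} (hu : u.1 ^ 2 + u.2 ^ 2 = 1) {f : E → ℝ}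
    (hf : Measurable f) :
    ∫ ζ, f (comb E u ζ) ∂((ProbabilityTheory.stdGaussian E).prod
      (ProbabilityTheory.stdGaussian E)) = ∫ x, f x ∂(ProbabilityTheory.stdGaussian E) := by
  have : SecondCountableTopology E := inferInstance
  conv_rhs => rw [← map_comb_stdGaussian hu]
  rw [integral_map (comb E u).continuous.measurable.aemeasurable hf.aestronglyMeasurable]

lemma ae_comp_comb {u : ℝ × ℝ} (hu : u.1 ^ 2 + u.2 ^ 2 = 1) {s : E → Prop}
    (h : ∀ᵐ x, s x) : ∀ᵐ ζ ∂((ProbabilityTheory.stdGaussian E).prod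
      (ProbabilityTheory.stdGaussian E)), s (comb E u ζ) := by
  have : SecondCountableTopology E := inferInstance
  refine ae_of_ae_map (comb E u).continuous.measurable.aemeasurable ?_
  rw [map_comb_stdGaussian hu]
  exact stdGaussian_absolutelyContinuous.ae_le h

lemma interior_Icc_prod (P Q : ℝ × ℝ) :
    interior (Set.Icc P Q) = Set.Ioo P.1 Q.1 ×ˢ Set.Ioo P.2 Q.2 := by
  rw [Set.Icc_prod_eq, interior_prod_eq, interior_Icc, interior_Icc]

variable {u₁ u₂ u₃ P Q : ℝ × ℝ} {H : ℝ × ℝ → ℝ} {ρ α β R m z₀ z₁ : ℝ}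

lemma continuousOn_powDiv {s : Set (ℝ × ℝ)} (hHc : ContinuousOn H s)
    (hpos : ∀ z ∈ s, 0 < H z) (hz₀ : 0 < z₀) :
    ContinuousOn (powDiv H R m) (s ×ˢ Set.Icc z₀ z₁) := by
  refine ContinuousOn.mul ?_ ?_
  · exact (hHc.comp continuousOn_fst fun w hw => hw.1).rpow_const fun w hw =>
      Or.inl (hpos _ hw.1).ne'
  · exact continuousOn_snd.rpow_const fun w hw => Or.inl (hz₀.trans_le hw.2.1).ne'

/-- The Gaussian Jensen inequality for `H(f, g) ^ R / ψ ^ m`. -/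
theorem powDiv_integral_le (hPQ₁ : P.1 < Q.1) (hPQ₂ : P.2 < Q.2)
    (hHc : ContinuousOn H (Set.Icc P Q)) (hH : ContDiffOn ℝ 3 H (interior (Set.Icc P Q)))
    (hpos : ∀ z ∈ Set.Icc P Q, 0 < H z) (hx : ∀ z ∈ interior (Set.Icc P Q), Hx H z ≠ 0)
    (hy : ∀ z ∈ interior (Set.Icc P Q), Hy H z ≠ 0) (hR : 0 < R)
    (hu : IsUnitGram u₁ u₂ u₃ ρ α β) (hQ : FormNonneg H (interior (Set.Icc P Q)) ρ α β R m)
    (hz₀ : 0 < z₀) (hz : z₀ < z₁) {f g ψ : E → ℝ} (hf : Measurable f) (hg : Measurable g)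
    (hψ : Measurable ψ) (hfm : ∀ x, f x ∈ Set.Icc P.1 Q.1) (hgm : ∀ x, g x ∈ Set.Icc P.2 Q.2)
    (hψm : ∀ x, ψ x ∈ Set.Icc z₀ z₁) :
    powDiv H R m ((∫ x, f x ∂(ProbabilityTheory.stdGaussian E),
        ∫ x, g x ∂(ProbabilityTheory.stdGaussian E)),
        ∫ x, ψ x ∂(ProbabilityTheory.stdGaussian E)) ≤
      ∫ ζ, powDiv H R m ((f (comb E u₁ ζ), g (comb E u₂ ζ)), ψ (comb E u₃ ζ))
        ∂((ProbabilityTheory.stdGaussian E).prod (ProbabilityTheory.stdGaussian E)) := by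
  have : SecondCountableTopology E := inferInstance
  set μ := (ProbabilityTheory.stdGaussian E).prod (ProbabilityTheory.stdGaussian E) with hμ
  obtain ⟨F₁, l₁, r₁, hF₁, hlr₁, hlim₁⟩ := exists_niceInto_tendsto volume hf hPQ₁ hfm
  obtain ⟨F₂, l₂, r₂, hF₂, hlr₂, hlim₂⟩ := exists_niceInto_tendsto volume hg hPQ₂ hgm
  obtain ⟨F₃, l₃, r₃, hF₃, hlr₃, hlim₃⟩ := exists_niceInto_tendsto volume hψ hz hψm
  have hc := fun u : ℝ × ℝ => (comb E u).continuous.measurable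
  have key : ∀ j, powDiv H R m
      (∫ ζ, ((F₁ j (comb E u₁ ζ), F₂ j (comb E u₂ ζ)), F₃ j (comb E u₃ ζ)) ∂μ) ≤
      ∫ ζ, powDiv H R m ((F₁ j (comb E u₁ ζ), F₂ j (comb E u₂ ζ)), F₃ j (comb E u₃ ζ)) ∂μ := by
    intro j
    obtain ⟨L, G, hs⟩ := exists_smoothInto (u₁ := u₁) (u₂ := u₂) (u₃ := u₃) (hF₁ j) (hF₂ j)
      (hF₃ j)
    have hK : IsCompact ((Set.Icc (l₁ j) (r₁ j) ×ˢ Set.Icc (l₂ j) (r₂ j)) ×ˢ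
        Set.Icc (l₃ j) (r₃ j)) := (isCompact_Icc.prod isCompact_Icc).prod isCompact_Icc
    have hKc : Convex ℝ ((Set.Icc (l₁ j) (r₁ j) ×ˢ Set.Icc (l₂ j) (r₂ j)) ×ˢ
        Set.Icc (l₃ j) (r₃ j)) := ((convex_Icc _ _).prod (convex_Icc _ _)).prod (convex_Icc _ _)
    have hKU : (Set.Icc (l₁ j) (r₁ j) ×ˢ Set.Icc (l₂ j) (r₂ j)) ×ˢ Set.Icc (l₃ j) (r₃ j) ⊆
        interior (Set.Icc P Q) ×ˢ Set.Ioi 0 := by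
      rw [interior_Icc_prod]
      exact Set.prod_mono (Set.prod_mono (Set.Icc_subset_Ioo (hlr₁ j).1 (hlr₁ j).2)
        (Set.Icc_subset_Ioo (hlr₂ j).1 (hlr₂ j).2))
        fun t ht => hz₀.trans ((hlr₃ j).1.trans_le ht.1)
    obtain ⟨M, hM, hB⟩ := exists_hessianNonneg_powDiv (E := E) isOpen_interior hH
      (fun z hz => hpos z (interior_subset hz)) hx hy hR hu hQ hK hKc hKU
    exact le_integral_comp integral_stdGaussian_prod hK hKc isClosed_factoring convex_factoring
      hB hM hs
  have hB := continuousOn_powDiv (R := R) (m := m) (z₁ := z₁) hHc hpos hz₀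
  have hlim : ∀ᵐ ζ ∂μ, Tendsto
      (fun j => ((F₁ j (comb E u₁ ζ), F₂ j (comb E u₂ ζ)), F₃ j (comb E u₃ ζ))) atTop
      (𝓝 ((f (comb E u₁ ζ), g (comb E u₂ ζ)), ψ (comb E u₃ ζ))) := by
    filter_upwards [ae_comp_comb hu.unit₁ hlim₁, ae_comp_comb hu.unit₂ hlim₂,
      ae_comp_comb hu.unit₃ hlim₃] with ζ h1 h2 h3
    exact (h1.prodMk_nhds h2).prodMk_nhds h3
  have hmem : ∀ {φ₁ φ₂ φ₃ : E → ℝ}, (∀ x, φ₁ x ∈ Set.Icc P.1 Q.1) →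
      (∀ x, φ₂ x ∈ Set.Icc P.2 Q.2) → (∀ x, φ₃ x ∈ Set.Icc z₀ z₁) → ∀ ζ,
      ((φ₁ (comb E u₁ ζ), φ₂ (comb E u₂ ζ)), φ₃ (comb E u₃ ζ)) ∈
        Set.Icc P Q ×ˢ Set.Icc z₀ z₁ := fun h1 h2 h3 ζ =>
    ⟨⟨⟨(h1 _).1, (h2 _).1⟩, ⟨(h1 _).2, (h2 _).2⟩⟩, h3 _⟩
  have hFm : ∀ {F : ℕ → E → ℝ} {l r : ℕ → ℝ} {s t : ℝ}, (∀ j, NiceInto (F j) (l j) (r j)) →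
      (∀ j, s < l j ∧ r j < t) → ∀ j x, F j x ∈ Set.Icc s t := fun hF hl j x =>
    ⟨(hl j).1.le.trans ((hF j).mem x).1, ((hF j).mem x).2.trans (hl j).2.le⟩
  have hmeas : ∀ {φ₁ φ₂ φ₃ : E → ℝ}, Measurable φ₁ → Measurable φ₂ → Measurable φ₃ →
      Measurable fun ζ => ((φ₁ (comb E u₁ ζ), φ₂ (comb E u₂ ζ)), φ₃ (comb E u₃ ζ)) :=
    fun h1 h2 h3 => ((h1.comp (hc u₁)).prodMk (h2.comp (hc u₂))).prodMk (h3.comp (hc u₃))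
  have main := le_integral_comp_of_tendsto (isCompact_Icc.prod isCompact_Icc)
    ((convex_Icc P Q).prod (convex_Icc z₀ z₁)) hB
    (fun j => hmeas (hF₁ j).contDiff.continuous.measurable (hF₂ j).contDiff.continuous.measurable
      (hF₃ j).contDiff.continuous.measurable) (hmeas hf hg hψ)
    (fun j => hmem (hFm hF₁ hlr₁ j) (hFm hF₂ hlr₂ j) (hFm hF₃ hlr₃ j)) (hmem hfm hgm hψm) hlim key
  have hint : ∀ {φ : E → ℝ} {s t : ℝ} (u : ℝ × ℝ), Measurable φ → (∀ x, φ x ∈ Set.Icc s t) →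
      Integrable (fun ζ => φ (comb E u ζ)) μ := fun {φ s t} u hφ hm =>
    Integrable.of_bound (C := max |s| |t|) (hφ.comp (hc u)).aestronglyMeasurable
      (ae_of_all _ fun ζ => abs_le_max_abs_abs (hm _).1 (hm _).2)
  rw [integral_pair ((hint u₁ hf hfm).prodMk (hint u₂ hg hgm)) (hint u₃ hψ hψm),
    integral_pair (hint u₁ hf hfm) (hint u₂ hg hgm), integral_comp_comb hu.unit₁ hf,
    integral_comp_comb hu.unit₂ hg, integral_comp_comb hu.unit₃ hψ] at main
  exact main

end ThreeFunctions

section Constants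

lemma exists_norm_fderiv_fderiv_le {s : Set (ℝ × ℝ)} (hs : IsCompact s) (hu : UniqueDiffOn ℝ s)
    {H : ℝ × ℝ → ℝ} (hH : ContDiffOn ℝ 3 H s) :
    ∃ C, ∀ z ∈ interior s, ‖fderiv ℝ (fderiv ℝ H) z‖ ≤ C := by
  have h1 : ContDiffOn ℝ 2 (fderivWithin ℝ H s) s := hH.fderivWithin hu (by norm_num)
  obtain ⟨C, hC⟩ := hs.exists_bound_of_continuousOn
    (h1.continuousOn_fderivWithin hu (by norm_num))
  refine ⟨C, fun z hz => ?_⟩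
  have hev : fderiv ℝ H =ᶠ[𝓝 z] fderivWithin ℝ H s := by
    filter_upwards [isOpen_interior.mem_nhds hz] with w hw
    rw [fderivWithin_of_mem_nhds (mem_interior_iff_mem_nhds.1 hw)]
  rw [hev.fderiv_eq, ← fderivWithin_of_mem_nhds (mem_interior_iff_mem_nhds.1 hz)]
  exact hC z (interior_subset hz)

lemma abs_apply_apply_le {D : ℝ × ℝ →L[ℝ] ℝ × ℝ →L[ℝ] ℝ} {C : ℝ} (hD : ‖D‖ ≤ C)
    {u v : ℝ × ℝ} (hu : ‖u‖ ≤ 1) (hv : ‖v‖ ≤ 1) : |D u v| ≤ C := by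
  have hC : 0 ≤ C := (norm_nonneg D).trans hD
  calc |D u v| ≤ ‖D‖ * ‖u‖ * ‖v‖ := D.le_opNorm₂ u v
    _ ≤ C * 1 * 1 := by gcongr
    _ = C := by ring

/-- The logarithmic second-order coefficients of `H` are bounded. -/
lemma exists_abs_coefficients_le {s : Set (ℝ × ℝ)} (hs : IsCompact s) (hu : UniqueDiffOn ℝ s)
    {H : ℝ × ℝ → ℝ} (hH : ContDiffOn ℝ 3 H s) {δ : ℝ} (hδ : 0 < δ)
    (hHx : ∀ z ∈ interior s, δ < |Hx H z|) (hHy : ∀ z ∈ interior s, δ < |Hy H z|) :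
    ∃ K, 0 ≤ K ∧ ∀ z ∈ interior s, |H z * Hxx H z / Hx H z ^ 2| ≤ K ∧
      |H z * Hxy H z / (Hx H z * Hy H z)| ≤ K ∧ |H z * Hyy H z / Hy H z ^ 2| ≤ K := by
  obtain ⟨C, hC⟩ := exists_norm_fderiv_fderiv_le hs hu hH
  obtain ⟨M, hM⟩ := hs.exists_bound_of_continuousOn hH.continuousOn
  refine ⟨|M| * |C| / δ ^ 2, by positivity, fun z hz => ?_⟩
  have hM' : |H z| ≤ |M| := (hM z (interior_subset hz)).trans (le_abs_self M)
  have hd : DifferentiableAt ℝ (fderiv ℝ H) z :=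
    (((hH.mono interior_subset).fderiv_of_isOpen (m := 2) isOpen_interior
      (by norm_num)).differentiableOn (by norm_num)).differentiableAt
      (isOpen_interior.mem_nhds hz)
  obtain ⟨exx, exy, eyy⟩ := second_partials_eq hd
  have hC' := (hC z hz).trans (le_abs_self C)
  have n₁ : ‖((1 : ℝ), (0 : ℝ))‖ ≤ 1 := by simp [Prod.norm_def]
  have n₂ : ‖((0 : ℝ), (1 : ℝ))‖ ≤ 1 := by simp [Prod.norm_def]
  have key : ∀ {k d e : ℝ}, |k| ≤ |C| → δ < |d| → δ < |e| →
      |H z * k / (d * e)| ≤ |M| * |C| / δ ^ 2 := by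
    intro k d e hk hd he
    rw [abs_div, abs_mul, abs_mul, sq]
    gcongr
  refine ⟨?_, ?_, ?_⟩
  · rw [sq]
    exact key (exx ▸ abs_apply_apply_le hC' n₁ n₁) (hHx z hz) (hHx z hz)
  · exact key (exy ▸ abs_apply_apply_le hC' n₂ n₁) (hHx z hz) (hHy z hz)
  · rw [sq]
    exact key (eyy ▸ abs_apply_apply_le hC' n₂ n₂) (hHy z hz) (hHy z hz)

/-- The partial differential inequality gives `FormNonneg` for all large exponents. -/
lemma exists_formNonneg {s : Set (ℝ × ℝ)} (hs : IsCompact s) (hu : UniqueDiffOn ℝ s)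
    {H : ℝ × ℝ → ℝ} (hH : ContDiffOn ℝ 3 H s) {δ : ℝ} (hδ : 0 < δ)
    (hHpos : ∀ z ∈ s, 0 < H z)
    (hHx : ∀ z ∈ interior s, δ < |Hx H z|) (hHy : ∀ z ∈ interior s, δ < |Hy H z|)
    {a b ρ : ℝ} (hρ : 1 - a ^ 2 - b ^ 2 = 2 * a * b * ρ) (hρ1 : 0 < 1 - ρ ^ 2)
    (hPDI : ∀ z ∈ interior s, 0 ≤ a ^ 2 * Hxx H z / (Hx H z) ^ 2
          + (1 - a ^ 2 - b ^ 2) * Hxy H z / (Hx H z * Hy H z)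
          + b ^ 2 * Hyy H z / (Hy H z) ^ 2) :
    ∃ c R₀ : ℝ, 0 < c ∧ ∀ R, R₀ < R → c + 1 < R ∧
      FormNonneg H (interior s) ρ (a + b * ρ) (b + a * ρ) R (R - c - 1) := by
  obtain ⟨K₀, hK₀, hK⟩ := exists_abs_coefficients_le hs hu hH hδ hHx hHy
  set α := a + b * ρ with hα
  set β := b + a * ρ with hβ
  set K := K₀ * (|a * β| + |ρ * (b * β - a * α)| + |b * α| + β ^ 2 + |2 * ρ * α * β| + α ^ 2)
    with hKdef
  refine ⟨2 * K ^ 2 / (1 - ρ ^ 2) + 1,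
    max (2 * K ^ 2 / (1 - ρ ^ 2) + 1 + 1) (2 * (K + (1 - ρ ^ 2)) / (1 - ρ ^ 2)), by positivity,
    fun R hR => ?_⟩
  have hR₁ := (le_max_left _ _).trans_lt hR
  have hR₂ := (le_max_right _ _).trans_lt hR
  refine ⟨hR₁, fun z hz s₁ s₂ s₃ => ?_⟩
  obtain ⟨k₁₁, k₁₂, k₂₂⟩ := hK z hz
  rw [sub_add_cancel (R - _) (1 : ℝ)]
  refine quadratic_form_nonneg (K := K) hα hβ hρ ?_ ?_ ?_ ?_ (by positivity) hR₁ hρ1 ?_ s₁ s₂ s₃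
  · have h := mul_nonneg (hHpos z (interior_subset hz)).le (hPDI z hz)
    rw [hρ] at h
    refine h.trans_eq ?_
    ring
  · generalize H z * Hxx H z / Hx H z ^ 2 = h₁₁ at *
    generalize H z * Hxy H z / (Hx H z * Hy H z) = h₁₂ at *
    generalize H z * Hyy H z / Hy H z ^ 2 = h₂₂ at *
    have e₁ : |h₁₁ * a * β| ≤ K₀ * |a * β| := by
      rw [mul_assoc, abs_mul]; gcongr
    have e₂ : |ρ * h₁₂ * (b * β - a * α)| ≤ K₀ * |ρ * (b * β - a * α)| := by
      rw [mul_comm ρ, mul_assoc, abs_mul]; gcongr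
    have e₃ : |h₂₂ * b * α| ≤ K₀ * |b * α| := by
      rw [mul_assoc, abs_mul]; gcongr
    calc _ ≤ |h₁₁ * a * β| + |ρ * h₁₂ * (b * β - a * α)| + |h₂₂ * b * α| :=
          (abs_sub _ _).trans (by gcongr; exact abs_add_le _ _)
      _ ≤ K₀ * |a * β| + K₀ * |ρ * (b * β - a * α)| + K₀ * |b * α| := by gcongr
      _ ≤ K := by
          have : 0 ≤ K₀ * (β ^ 2 + |2 * ρ * α * β| + α ^ 2) := by positivity
          linarith
  · generalize H z * Hxx H z / Hx H z ^ 2 = h₁₁ at *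
    generalize H z * Hxy H z / (Hx H z * Hy H z) = h₁₂ at *
    generalize H z * Hyy H z / Hy H z ^ 2 = h₂₂ at *
    have e₁ : |h₁₁ * β ^ 2| ≤ K₀ * β ^ 2 := by
      rw [abs_mul, abs_of_nonneg (sq_nonneg β)]; gcongr
    have e₂ : |2 * ρ * h₁₂ * α * β| ≤ K₀ * |2 * ρ * α * β| := by
      rw [show 2 * ρ * h₁₂ * α * β = h₁₂ * (2 * ρ * α * β) by ring, abs_mul]; gcongr
    have e₃ : |h₂₂ * α ^ 2| ≤ K₀ * α ^ 2 := by
      rw [abs_mul, abs_of_nonneg (sq_nonneg α)]; gcongr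
    calc _ ≤ |h₁₁ * β ^ 2| + |2 * ρ * h₁₂ * α * β| + |h₂₂ * α ^ 2| :=
          (abs_add_le _ _).trans (by gcongr; exact abs_sub _ _)
      _ ≤ K₀ * β ^ 2 + K₀ * |2 * ρ * α * β| + K₀ * α ^ 2 := by gcongr
      _ ≤ K := by
          have : 0 ≤ K₀ * (|a * β| + |ρ * (b * β - a * α)| + |b * α|) := by positivity
          linarith
  · rw [add_mul, div_mul_cancel₀ _ hρ1.ne']
    linarith
  · rw [div_lt_iff₀ hρ1] at hR₂
    linarith

end Constants

section Duality

variable {E : Type*} [NormedAddCommGroup E] [InnerProductSpace ℝ E] [FiniteDimensional ℝ E]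
  [MeasurableSpace E] [BorelSpace E]

/-- The duality step: `powDiv_integral_le` applied to `ψ = w ^ (1 / N)`, where `w` is the inner
integral. -/
theorem rpow_le_integral_rpow {u₁ u₂ P Q : ℝ × ℝ} {H : ℝ × ℝ → ℝ} {ρ α β R N δ : ℝ}
    (hPQ₁ : P.1 < Q.1) (hPQ₂ : P.2 < Q.2)
    (hHc : ContinuousOn H (Set.Icc P Q)) (hH : ContDiffOn ℝ 3 H (interior (Set.Icc P Q)))
    (hδ : 0 < δ) (hpos : ∀ z ∈ Set.Icc P Q, δ < H z)
    (hx : ∀ z ∈ interior (Set.Icc P Q), Hx H z ≠ 0)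
    (hy : ∀ z ∈ interior (Set.Icc P Q), Hy H z ≠ 0) (hR : 0 < R) (hN : 0 < N)
    (hu : IsUnitGram u₁ u₂ (1, 0) ρ α β)
    (hQ : FormNonneg H (interior (Set.Icc P Q)) ρ α β R (N - 1)) {f g : E → ℝ}
    (hf : Measurable f) (hg : Measurable g) (hfm : ∀ x, f x ∈ Set.Icc P.1 Q.1)
    (hgm : ∀ x, g x ∈ Set.Icc P.2 Q.2) :
    H (∫ x, f x ∂(ProbabilityTheory.stdGaussian E),
        ∫ x, g x ∂(ProbabilityTheory.stdGaussian E)) ^ (R / N) ≤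
      ∫ x, (∫ η, H (f (comb E u₁ (x, η)), g (comb E u₂ (x, η))) ^ R
        ∂(ProbabilityTheory.stdGaussian E)) ^ (1 / N) ∂(ProbabilityTheory.stdGaussian E) := by
  have : SecondCountableTopology E := inferInstance
  set γ := ProbabilityTheory.stdGaussian E with hγ
  obtain ⟨M, hM⟩ := isCompact_Icc.exists_bound_of_continuousOn hHc
  have hpos' : ∀ z ∈ Set.Icc P Q, 0 < H z := fun z hz => hδ.trans (hpos z hz)
  have hM' : ∀ z ∈ Set.Icc P Q, H z ≤ M := fun z hz => (le_abs_self _).trans (hM z hz)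
  have hmem : ∀ x y, (f x, g y) ∈ Set.Icc P Q := fun x y =>
    ⟨⟨(hfm x).1, (hgm y).1⟩, ⟨(hfm x).2, (hgm y).2⟩⟩
  have hδM : δ < M := (hpos _ (hmem 0 0)).trans_le (hM' _ (hmem 0 0))
  set Φ : E × E → ℝ := fun ζ => H (f (comb E u₁ ζ), g (comb E u₂ ζ)) ^ R with hΦ
  have hΦmeas : Measurable Φ :=
    measurable_comp_of_mem isCompact_Icc (B := fun z => H z ^ R)
      (hHc.rpow_const fun z hz => Or.inl (hpos' z hz).ne')
      ((hf.comp (comb E u₁).continuous.measurable).prodMk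
        (hg.comp (comb E u₂).continuous.measurable)) fun ζ => hmem _ _
  have hΦmem : ∀ ζ, Φ ζ ∈ Set.Icc (δ ^ R) (M ^ R) := fun ζ =>
    ⟨Real.rpow_le_rpow hδ.le (hpos _ (hmem _ _)).le hR.le,
      Real.rpow_le_rpow (hpos' _ (hmem _ _)).le (hM' _ (hmem _ _)) hR.le⟩
  have hδR : 0 < δ ^ R := Real.rpow_pos_of_pos hδ R
  have hMR : δ ^ R < M ^ R := Real.rpow_lt_rpow hδ.le hδM hR
  have hMR0 : 0 < M ^ R := hδR.trans hMR
  set w : E → ℝ := fun x => ∫ η, Φ (x, η) ∂γ with hw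
  have hwmeas : Measurable w :=
    (StronglyMeasurable.integral_prod_right (ν := γ) hΦmeas.stronglyMeasurable).measurable
  have hΦint : ∀ x, Integrable (fun η => Φ (x, η)) γ := fun x =>
    Integrable.of_bound (C := M ^ R) (hΦmeas.comp measurable_prodMk_left).aestronglyMeasurable
      (ae_of_all _ fun η => by
        rw [Real.norm_of_nonneg (hδR.le.trans (hΦmem _).1)]
        exact (hΦmem _).2)
  have hwmem : ∀ x, w x ∈ Set.Icc (δ ^ R) (M ^ R) := fun x =>
    (convex_Icc _ _).integral_mem isClosed_Icc (ae_of_all _ fun η => hΦmem (x, η)) (hΦint x)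
  have hwpos : ∀ x, 0 < w x := fun x => hδR.trans_le (hwmem x).1
  set ψ : E → ℝ := fun x => w x ^ (1 / N) with hψ
  have hN' : 0 < 1 / N := by positivity
  have hψmeas : Measurable ψ := hwmeas.pow_const _
  set z₀ := (δ ^ R) ^ (1 / N) with hz₀
  set z₁ := (M ^ R) ^ (1 / N) with hz₁
  have hz₀0 : 0 < z₀ := Real.rpow_pos_of_pos hδR _
  have hz : z₀ < z₁ := Real.rpow_lt_rpow hδR.le hMR hN'
  have hψmem : ∀ x, ψ x ∈ Set.Icc z₀ z₁ := fun x =>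
    ⟨Real.rpow_le_rpow hδR.le (hwmem x).1 hN'.le, Real.rpow_le_rpow (hwpos x).le (hwmem x).2 hN'.le⟩
  have hψpos : ∀ x, 0 < ψ x := fun x => hz₀0.trans_le (hψmem x).1
  have main := powDiv_integral_le hPQ₁ hPQ₂ hHc hH hpos' hx hy hR hu hQ hz₀0 hz hf hg hψmeas
    hfm hgm hψmem
  have hrhs : ∫ ζ, powDiv H R (N - 1) ((f (comb E u₁ ζ), g (comb E u₂ ζ)), ψ (comb E (1, 0) ζ))
      ∂(γ.prod γ) = ∫ x, ψ x ∂γ := by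
    have hint : Integrable (fun ζ : E × E => Φ ζ * ψ ζ.1 ^ (-(N - 1))) (γ.prod γ) := by
      have hcont : ContinuousOn (fun t : ℝ × ℝ => t.1 * t.2 ^ (-(N - 1)))
          (Set.Icc (δ ^ R) (M ^ R) ×ˢ Set.Icc z₀ z₁) :=
        continuousOn_fst.mul (continuousOn_snd.rpow_const fun t ht =>
          Or.inl (hz₀0.trans_le ht.2.1).ne')
      have hK : IsCompact (Set.Icc (δ ^ R) (M ^ R) ×ˢ Set.Icc z₀ z₁) :=
        isCompact_Icc.prod isCompact_Icc
      obtain ⟨C, hC⟩ := hK.exists_bound_of_continuousOn hcont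
      exact Integrable.of_bound (C := C)
        (hΦmeas.mul ((hψmeas.comp measurable_fst).pow_const _)).aestronglyMeasurable
        (ae_of_all _ fun ζ => hC (Φ ζ, ψ ζ.1) ⟨hΦmem ζ, hψmem ζ.1⟩)
    calc _ = ∫ ζ, Φ ζ * ψ ζ.1 ^ (-(N - 1)) ∂(γ.prod γ) := by simp [powDiv, hΦ]
      _ = ∫ x, ∫ η, Φ (x, η) * ψ x ^ (-(N - 1)) ∂γ ∂γ := integral_prod _ hint
      _ = ∫ x, ψ x ∂γ := by
          refine integral_congr_ae (ae_of_all _ fun x => ?_)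
          have e : w x = ψ x ^ N := by
            rw [hψ, ← Real.rpow_mul (hwpos x).le, one_div_mul_cancel hN.ne', Real.rpow_one]
          simp only
          rw [integral_mul_const]
          change w x * _ = _
          rw [e, ← Real.rpow_add (hψpos x), show N + -(N - 1) = 1 by ring, Real.rpow_one]
  rw [hrhs] at main
  have hψint : Integrable ψ γ := Integrable.of_bound (C := z₁) hψmeas.aestronglyMeasurable
    (ae_of_all _ fun x => by
      rw [Real.norm_of_nonneg (hψpos x).le]
      exact (hψmem x).2)
  have hEψ : 0 < ∫ x, ψ x ∂γ := hz₀0.trans_le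
    ((convex_Icc _ _).integral_mem isClosed_Icc (ae_of_all _ hψmem) hψint).1
  have hEmem : (∫ x, f x ∂γ, ∫ x, g x ∂γ) ∈ Set.Icc P Q := by
    have h1 : ∀ {φ : E → ℝ} {s t : ℝ}, Measurable φ → (∀ x, φ x ∈ Set.Icc s t) →
        ∫ x, φ x ∂γ ∈ Set.Icc s t := fun {φ s t} hφ hm =>
      (convex_Icc s t).integral_mem isClosed_Icc (ae_of_all _ hm)
        (Integrable.of_bound (C := max |s| |t|) hφ.aestronglyMeasurable
          (ae_of_all _ fun x => abs_le_max_abs_abs (hm x).1 (hm x).2))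
    exact ⟨⟨(h1 hf hfm).1, (h1 hg hgm).1⟩, ⟨(h1 hf hfm).2, (h1 hg hgm).2⟩⟩
  have hHE := hpos' _ hEmem
  have h2 : H (∫ x, f x ∂γ, ∫ x, g x ∂γ) ^ R ≤ (∫ x, ψ x ∂γ) ^ N := by
    simp only [powDiv] at main
    rw [Real.rpow_neg hEψ.le, ← div_eq_mul_inv, div_le_iff₀ (Real.rpow_pos_of_pos hEψ _)] at main
    refine main.trans_eq ?_
    conv_lhs => rw [← Real.rpow_one (∫ x, ψ x ∂γ)]
    rw [← Real.rpow_mul hEψ.le, one_mul, ← Real.rpow_add hEψ, add_sub_cancel]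
  have h3 := Real.rpow_le_rpow (by positivity) h2 hN'.le
  rwa [← Real.rpow_mul hHE.le, ← Real.rpow_mul hEψ.le, mul_one_div, mul_one_div, div_self hN.ne',
    Real.rpow_one] at h3

end Duality

end GaussianHeat

/-- the key lemma in the elliptic case `|a−b| < 1`, `a+b > 1`. -/
theorem stmt5 (n : ℕ) (P Q : ℝ × ℝ) (hPQ1 : P.1 < Q.1) (hPQ2 : P.2 < Q.2)
    (H : ℝ × ℝ → ℝ) (hH : ContDiffOn ℝ 3 H (Set.Icc P Q))
    (δ : ℝ) (hδ : 0 < δ)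
    (hHpos : ∀ z ∈ Set.Icc P Q, δ < H z)
    (hHx : ∀ z ∈ interior (Set.Icc P Q), δ < |Hx H z|)
    (hHy : ∀ z ∈ interior (Set.Icc P Q), δ < |Hy H z|)
    (a b : ℝ) (ha : 0 < a) (hb : 0 < b)
    (hab1 : |a - b| < 1) (hab2 : 1 < a + b)
    (hPDI : ∀ z ∈ interior (Set.Icc P Q),
      0 ≤ a ^ 2 * Hxx H z / (Hx H z) ^ 2
          + (1 - a ^ 2 - b ^ 2) * Hxy H z / (Hx H z * Hy H z)
          + b ^ 2 * Hyy H z / (Hy H z) ^ 2) :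
    ∃ c R₀ : ℝ, 0 < c ∧ ∀ R : ℝ, R₀ < R → ∀ p q : ℝ,
      p = 4 / ((1 - (a - b) ^ 2) * ((a + b) ^ 2 - 1)) →
      q = 2 * (a ^ 2 - b ^ 2 - 1) / ((1 - (a - b) ^ 2) * ((a + b) ^ 2 - 1)) →
      ∀ f g : Euc n → ℝ, Measurable f → Measurable g →
        (∀ x y, (f x, g y) ∈ Set.Icc P Q) →
        H (∫ x, f x ∂(stdGaussian n), ∫ x, g x ∂(stdGaussian n)) ^ (R / (R - c)) ≤
          ∫ x, (∫ y, H (f (a⁻¹ • (x - y)), g (b⁻¹ • y)) ^ R ∂(gammaPQX n p q x))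
              ^ (1 / (R - c)) ∂(stdGaussian n) := by
  have hD₁ : 0 < 1 - (a - b) ^ 2 := by
    have := (sq_lt_one_iff_abs_lt_one (a - b)).2 hab1
    linarith
  have hD₂ : 0 < (a + b) ^ 2 - 1 := by nlinarith
  have hD := mul_pos hD₁ hD₂
  set ρ := (1 - a ^ 2 - b ^ 2) / (2 * a * b) with hρdef
  have hρ : 1 - a ^ 2 - b ^ 2 = 2 * a * b * ρ := by
    rw [hρdef]
    field_simp
  have hρ1 : 0 < 1 - ρ ^ 2 := by
    have e : 1 - ρ ^ 2 = (1 - (a - b) ^ 2) * ((a + b) ^ 2 - 1) / (2 * a * b) ^ 2 := by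
      rw [hρdef]
      field_simp
      ring
    rw [e]
    positivity
  have hu : UniqueDiffOn ℝ (Set.Icc P Q) := by
    rw [Set.Icc_prod_eq]
    exact (uniqueDiffOn_Icc hPQ1).prod (uniqueDiffOn_Icc hPQ2)
  obtain ⟨c, R₀, hc, h⟩ := GaussianHeat.exists_formNonneg isCompact_Icc hu hH hδ
    (fun z hz => hδ.trans (hHpos z hz)) hHx hHy hρ hρ1 hPDI
  refine ⟨c, R₀, hc, fun R hR p q hp hq f g hf hg hfg => ?_⟩
  obtain ⟨hRc, hQ⟩ := h R hR
  have hp0 : 0 < p := by rw [hp]; positivity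
  have key := GaussianHeat.rpow_le_integral_rpow (E := Euc n) (N := R - c) hPQ1 hPQ2 hH.continuousOn
    (hH.mono interior_subset) hδ hHpos (fun z hz => abs_pos.1 (hδ.trans (hHx z hz)))
    (fun z hz => abs_pos.1 (hδ.trans (hHy z hz))) (by linarith) (by linarith)
    (GaussianHeat.isUnitGram_kernel ha hb hD hp hq) hQ hf hg
    (fun x => ⟨(hfg x 0).1.1, (hfg x 0).2.1⟩) (fun x => ⟨(hfg 0 x).1.2, (hfg 0 x).2.2⟩)
  rw [GaussianHeat.stdGaussian_eq]
  refine key.trans_eq ?_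
  simp only [GaussianHeat.integral_gammaPQX hp0]
  have e₁ : ∀ x η : Euc n, GaussianHeat.comb (Euc n) (a⁻¹ * (1 + q / p), -(a⁻¹ * (√p)⁻¹)) (x, η) =
      a⁻¹ • (x - ((-(q / p)) • x + (√p)⁻¹ • η)) := fun x η => by
    rw [GaussianHeat.comb_apply]
    module
  have e₂ : ∀ x η : Euc n, GaussianHeat.comb (Euc n) (-(b⁻¹ * (q / p)), b⁻¹ * (√p)⁻¹) (x, η) =
      b⁻¹ • ((-(q / p)) • x + (√p)⁻¹ • η) := fun x η => by
    rw [GaussianHeat.comb_apply]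
    module
  simp only [e₁, e₂]

end
end

section
/- Let μ be a probability measure on ℝ with density e^{−V}, where e^{−V} ∈ C²(ℝ) is everywhere positive, and with ∫_ℝ |t|⁵ dμ(t) < ∞. Let Φ(s) = μ((−∞, s]), let a, b > 0, and define H on [0,1]² by H(x,y) = Φ(a Φ^{−1}(x) + b Φ^{−1}(y)) for (x,y) ∈ [0,1]² \ {(0,1),(1,0)} (with the conventions Φ^{−1}(0) = −∞, Φ^{−1}(1) = +∞, Φ(−∞) = 0, Φ(+∞) = 1) and H(0,1) = H(1,0) = 0. If H satisfies inequality (★) for μ with n = 1 (for all Borel measurable (f,g) : ℝ × ℝ → [0,1]²), then: (i) V'(ax+by) ≤ a V'(x) + b V'(y) for all x, y ∈ ℝ; (ii) ((1−a²−b²)/(2ab))² ≤ 1; and (iii) if a+b > 1 then ∫_ℝ t dμ(t) = 0. -/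
open MeasureTheory Real Filter

noncomputable section

/-- Inequality (★) in dimension `n = 1`. -/
def StarIneq1 (a b : ℝ) (Ω : Set (ℝ × ℝ)) (H : ℝ × ℝ → ℝ) (μ : Measure ℝ) : Prop :=
  ∀ f g : ℝ → ℝ, Measurable f → Measurable g →
    (∀ x y, (f x, g y) ∈ Ω) →
    H (∫ x, f x ∂μ, ∫ x, g x ∂μ) ≤
      ∫ x, essSup (fun y => H (f ((x - y) / a), g (y / b))) volume ∂μ

open scoped Topology

/-- A function that is `O(h ^ k)` at the origin and grows at most like `1 + |h| ^ k` is globally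
bounded by a multiple of `|h| ^ k`. -/
lemma exists_forall_abs_le_mul_pow {R : ℝ → ℝ} {k : ℕ} {L K : ℝ} (hR0 : R 0 = 0)
    (hlim : Tendsto (fun h => R h / h ^ k) (𝓝[≠] 0) (𝓝 L))
    (hK : ∀ h, |R h| ≤ K * (1 + |h| ^ k)) : ∃ C, ∀ h, |R h| ≤ C * |h| ^ k := by
  have hK0 : 0 ≤ K := by
    have h1 := (abs_nonneg _).trans (hK 1)
    simp only [abs_one, one_pow] at h1
    linarith
  have hev : ∀ᶠ h in 𝓝[≠] (0 : ℝ), |R h / h ^ k| < |L| + 1 :=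
    hlim.abs.eventually (gt_mem_nhds (by linarith))
  rw [eventually_nhdsWithin_iff, Metric.eventually_nhds_iff] at hev
  obtain ⟨δ, hδ, hev⟩ := hev
  have hδk : 0 < δ ^ k := by positivity
  refine ⟨(|L| + 1) + K * (1 / δ ^ k + 1), fun h => ?_⟩
  rcases eq_or_ne h 0 with rfl | h0
  · rw [hR0, abs_zero]
    positivity
  have hp : 0 < |h| ^ k := by positivity
  rcases lt_or_ge |h| δ with hh | hh
  · have h1 := hev (y := h) (by simpa using hh) h0
    rw [abs_div, abs_pow, div_lt_iff₀ hp] at h1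
    have h2 : 0 ≤ K * (1 / δ ^ k + 1) * |h| ^ k := by positivity
    linarith
  · have h1 : δ ^ k ≤ |h| ^ k := pow_le_pow_left₀ hδ.le hh k
    have h2 : 1 ≤ 1 / δ ^ k * |h| ^ k := by
      rw [one_div, inv_mul_eq_div, le_div_iff₀ hδk]
      linarith
    calc |R h| ≤ K * (1 + |h| ^ k) := hK h
      _ ≤ K * (1 / δ ^ k * |h| ^ k + |h| ^ k) := by gcongr
      _ ≤ ((|L| + 1) + K * (1 / δ ^ k + 1)) * |h| ^ k := by
        have : 0 ≤ (|L| + 1) * |h| ^ k := by positivity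
        linarith

lemma tendsto_integral_comp_mul_div_pow {μ : Measure ℝ} {R q : ℝ → ℝ} {k : ℕ} {L K : ℝ}
    (hk : k ≠ 0) (hR0 : R 0 = 0) (hRc : Continuous R) (hq : Continuous q)
    (hlim : Tendsto (fun h => R h / h ^ k) (𝓝[≠] 0) (𝓝 L))
    (hK : ∀ h, |R h| ≤ K * (1 + |h| ^ k)) (hint : Integrable (fun x => q x ^ k) μ) :
    Tendsto (fun ε => ∫ x, R (ε * q x) / ε ^ k ∂μ) (𝓝[>] 0) (𝓝 (L * ∫ x, q x ^ k ∂μ)) := by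
  obtain ⟨C, hC⟩ := exists_forall_abs_le_mul_pow hR0 hlim hK
  rw [← integral_const_mul]
  refine tendsto_integral_filter_of_dominated_convergence (fun x => C * |q x ^ k|) ?_ ?_
    (hint.abs.const_mul C) ?_
  · exact Eventually.of_forall fun ε => (by fun_prop : Continuous _).aestronglyMeasurable
  · filter_upwards [self_mem_nhdsWithin] with ε (hε : 0 < ε)
    refine Eventually.of_forall fun x => ?_
    have hp : 0 < ε ^ k := by positivity
    rw [Real.norm_eq_abs, abs_div, abs_of_pos hp, div_le_iff₀ hp]
    have h1 := hC (ε * q x)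
    rw [abs_mul, mul_pow, abs_of_pos hε] at h1
    rw [abs_pow]
    linarith
  · refine Eventually.of_forall fun x => ?_
    rcases eq_or_ne (q x) 0 with h0 | h0
    · simp [h0, hR0, hk]
    have h1 : Tendsto (fun ε => ε * q x) (𝓝[>] 0) (𝓝[≠] 0) := by
      refine tendsto_nhdsWithin_iff.2 ⟨?_, ?_⟩
      · have : Tendsto (fun ε : ℝ => ε * q x) (𝓝 0) (𝓝 (0 * q x)) :=
          tendsto_id.mul_const _
        rw [zero_mul] at this
        exact this.mono_left nhdsWithin_le_nhds
      · filter_upwards [self_mem_nhdsWithin] with ε (hε : 0 < ε)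
        exact mul_ne_zero hε.ne' h0
    refine ((hlim.comp h1).mul_const (q x ^ k)).congr' ?_
    filter_upwards [self_mem_nhdsWithin] with ε (hε : 0 < ε)
    have := hε.ne'
    simp only [Function.comp_apply, mul_pow]
    field_simp

/-- Second order Taylor expansion with Peano remainder. -/
lemma tendsto_taylor_two {Φ φ : ℝ → ℝ} {s d : ℝ} (hΦ : ∀ x, HasDerivAt Φ (φ x) x)
    (hφ : HasDerivAt φ d s) :
    Tendsto (fun h => (Φ (s + h) - Φ s - h * φ s) / h ^ 2) (𝓝[≠] 0) (𝓝 (d / 2)) := by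
  have hnum : ∀ h, HasDerivAt (fun h => Φ (s + h) - Φ s - h * φ s) (φ (s + h) - φ s) h := by
    intro h
    have h1 : HasDerivAt (fun h => Φ (s + h)) (φ (s + h)) h :=
      HasDerivAt.comp_const_add s h (hΦ (s + h))
    have h2 := (hasDerivAt_id h).mul_const (φ s)
    rw [one_mul] at h2
    exact (h1.sub_const (Φ s)).sub h2
  have hden : ∀ h : ℝ, HasDerivAt (fun h : ℝ => h ^ 2) (2 * h) h := fun h => by
    simpa using hasDerivAt_pow 2 h
  refine HasDerivAt.lhopital_zero_nhdsNE (f' := fun h => φ (s + h) - φ s)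
    (g' := fun h => 2 * h) (Eventually.of_forall hnum) (Eventually.of_forall hden) ?_ ?_ ?_ ?_
  · filter_upwards [self_mem_nhdsWithin] with h (hh : h ≠ 0)
    exact mul_ne_zero two_ne_zero hh
  · have := (hnum 0).continuousAt.tendsto
    simp only [add_zero, sub_self, zero_mul] at this
    exact this.mono_left nhdsWithin_le_nhds
  · have := (hden 0).continuousAt.tendsto
    simp only [ne_eq, OfNat.ofNat_ne_zero, not_false_eq_true, zero_pow] at this
    exact this.mono_left nhdsWithin_le_nhds
  · refine (hφ.tendsto_slope_zero.div_const 2).congr fun h => ?_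
    rw [smul_eq_mul, inv_mul_eq_div, div_div, mul_comm h 2]

/-- If the means `Φi (A j ε)` behave like `s j + ℓ j * ε ^ k` and satisfy the superadditivity
relation with weights `a`, `b`, then so do the coefficients `ℓ j`. -/
lemma coeff_le_of_expansions {Φ Φi φ : ℝ → ℝ} {a b s t : ℝ} {k : ℕ} {A₁ A₂ A₃ : ℝ → ℝ}
    {ℓ₁ ℓ₂ ℓ₃ : ℝ} (ha : 0 < a) (hb : 0 < b) (hk : k ≠ 0) (hmono : StrictMono Φ)
    (hderiv : ∀ x, HasDerivAt Φ (φ x) x) (hpos : ∀ x, 0 < φ x)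
    (hΦi : ∀ x ∈ Set.Ioo (0 : ℝ) 1, Φ (Φi x) = x)
    (hA₁ : ∀ ε, A₁ ε ∈ Set.Ioo (0 : ℝ) 1) (hA₂ : ∀ ε, A₂ ε ∈ Set.Ioo (0 : ℝ) 1)
    (hlim₁ : Tendsto (fun ε => (A₁ ε - Φ s) / ε ^ k) (𝓝[>] 0) (𝓝 (φ s * ℓ₁)))
    (hlim₂ : Tendsto (fun ε => (A₂ ε - Φ t) / ε ^ k) (𝓝[>] 0) (𝓝 (φ t * ℓ₂)))
    (hlim₃ : Tendsto (fun ε => (A₃ ε - Φ (a * s + b * t)) / ε ^ k) (𝓝[>] 0)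
      (𝓝 (φ (a * s + b * t) * ℓ₃)))
    (hle : ∀ ε, 0 ≤ ε → Φ (a * Φi (A₁ ε) + b * Φi (A₂ ε)) ≤ A₃ ε) :
    a * ℓ₁ + b * ℓ₂ ≤ ℓ₃ := by
  have hexp : ∀ x κ, Tendsto (fun ε => (Φ (x + κ * ε ^ k) - Φ x) / ε ^ k) (𝓝[>] 0)
      (𝓝 (φ x * κ)) := by
    intro x κ
    have h1 : HasDerivAt (fun η => Φ (x + κ * η)) (φ x * κ) 0 := by
      have h2 : HasDerivAt (fun η => x + κ * η) κ 0 := by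
        simpa using ((hasDerivAt_id (0 : ℝ)).const_mul κ).const_add x
      have h3 : HasDerivAt Φ (φ x) (x + κ * 0) := by simpa using hderiv x
      exact h3.comp 0 h2
    have h4 : Tendsto (fun ε : ℝ => ε ^ k) (𝓝[>] 0) (𝓝[≠] 0) := by
      refine tendsto_nhdsWithin_iff.2 ⟨?_, ?_⟩
      · have := (continuous_pow (M := ℝ) k).tendsto 0
        rw [zero_pow hk] at this
        exact this.mono_left nhdsWithin_le_nhds
      · filter_upwards [self_mem_nhdsWithin] with ε (hε : 0 < ε)
        exact (pow_pos hε k).ne'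
    refine (h1.tendsto_slope_zero.comp h4).congr fun ε => ?_
    simp [inv_mul_eq_div]
  have hlow : ∀ {A : ℝ → ℝ} {x ℓ κ : ℝ}, (∀ ε, A ε ∈ Set.Ioo (0 : ℝ) 1) →
      Tendsto (fun ε => (A ε - Φ x) / ε ^ k) (𝓝[>] 0) (𝓝 (φ x * ℓ)) → κ < ℓ →
      ∀ᶠ ε in 𝓝[>] (0 : ℝ), x + κ * ε ^ k < Φi (A ε) := by
    intro A x ℓ κ hA hlim hκ
    filter_upwards [(hexp x κ).eventually_lt hlim (mul_lt_mul_of_pos_left hκ (hpos x)),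
      self_mem_nhdsWithin] with ε h1 (hε : 0 < ε)
    rw [div_lt_div_iff_of_pos_right (pow_pos hε k)] at h1
    rw [← hmono.lt_iff_lt, hΦi _ (hA ε)]
    linarith
  by_contra! hlt
  set η := (a * ℓ₁ + b * ℓ₂ - ℓ₃) / (a + b + 1) with hη
  have hη0 : 0 < η := div_pos (by linarith) (by linarith)
  have hηm : η * (a + b + 1) = a * ℓ₁ + b * ℓ₂ - ℓ₃ := div_mul_cancel₀ _ (by positivity)
  have hup := (hlim₃.eventually_lt (hexp (a * s + b * t) (ℓ₃ + η))
    (mul_lt_mul_of_pos_left (by linarith) (hpos _)))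
  obtain ⟨ε, h1, h2, h3, hε⟩ := ((hlow hA₁ hlim₁ (sub_lt_self ℓ₁ hη0)).and
    ((hlow hA₂ hlim₂ (sub_lt_self ℓ₂ hη0)).and (hup.and self_mem_nhdsWithin))).exists
  have hp : 0 < ε ^ k := pow_pos hε k
  rw [div_lt_div_iff_of_pos_right hp] at h3
  have h4 : a * Φi (A₁ ε) + b * Φi (A₂ ε) < a * s + b * t + (ℓ₃ + η) * ε ^ k := by
    rw [← hmono.lt_iff_lt]
    linarith [hle ε (le_of_lt hε)]
  have h5 := mul_lt_mul_of_pos_left h1 ha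
  have h6 := mul_lt_mul_of_pos_left h2 hb
  have h7 : (a * (ℓ₁ - η) + b * (ℓ₂ - η)) * ε ^ k < (ℓ₃ + η) * ε ^ k := by linarith
  have h8 := lt_of_mul_lt_mul_right h7 hp.le
  linarith

/-- (★) for `f = Φ ∘ u`, `g = Φ ∘ v`, where `w` dominates the sup-convolution of `u` and `v`. -/
lemma StarIneq1.le_integral_comp {a b : ℝ} {H : ℝ × ℝ → ℝ} {μ : Measure ℝ}
    [IsProbabilityMeasure μ] {Φ Φi : ℝ → ℝ}
    (hstar : StarIneq1 a b (Set.Icc ((0 : ℝ), (0 : ℝ)) (1, 1)) H μ)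
    (ha : 0 < a) (hb : 0 < b) (hmono : StrictMono Φ) (hcont : Continuous Φ)
    (hrange : ∀ x, Φ x ∈ Set.Ioo (0 : ℝ) 1) (hΦi : ∀ x ∈ Set.Ioo (0 : ℝ) 1, Φ (Φi x) = x)
    (hH : ∀ x ∈ Set.Ioo (0 : ℝ) 1, ∀ y ∈ Set.Ioo (0 : ℝ) 1,
      H (x, y) = Φ (a * Φi x + b * Φi y))
    {u v w : ℝ → ℝ} (hu : Continuous u) (hv : Continuous v) (hw : Continuous w)
    (huvw : ∀ x y, a * u x + b * v y ≤ w (a * x + b * y))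
    (hiu : ∫ x, Φ (u x) ∂μ ∈ Set.Ioo (0 : ℝ) 1) (hiv : ∫ x, Φ (v x) ∂μ ∈ Set.Ioo (0 : ℝ) 1) :
    Φ (a * Φi (∫ x, Φ (u x) ∂μ) + b * Φi (∫ x, Φ (v x) ∂μ)) ≤ ∫ x, Φ (w x) ∂μ := by
  have hinv : ∀ x, Φi (Φ x) = x := fun x => hmono.injective (hΦi _ (hrange x))
  have key := hstar (fun x => Φ (u x)) (fun x => Φ (v x)) (hcont.comp hu).measurable
    (hcont.comp hv).measurable fun x y =>
      ⟨⟨(hrange _).1.le, (hrange _).1.le⟩, ⟨(hrange _).2.le, (hrange _).2.le⟩⟩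
  rw [hH _ hiu _ hiv] at key
  refine key.trans ?_
  have heq : ∀ x y, H (Φ (u ((x - y) / a)), Φ (v (y / b))) =
      Φ (a * u ((x - y) / a) + b * v (y / b)) := fun x y => by
    rw [hH _ (hrange _) _ (hrange _), hinv, hinv]
  simp only [heq]
  have hbdd : ∀ x, IsBoundedUnder (· ≤ ·) (ae (volume : Measure ℝ))
      (fun y => Φ (a * u ((x - y) / a) + b * v (y / b))) := fun x =>
    isBoundedUnder_of ⟨1, fun y => (hrange _).2.le⟩
  have hcobdd : ∀ x, IsCoboundedUnder (· ≤ ·) (ae (volume : Measure ℝ))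
      (fun y => Φ (a * u ((x - y) / a) + b * v (y / b))) := fun x =>
    (isBoundedUnder_of ⟨0, fun y => (hrange _).1.le⟩ :
      IsBoundedUnder (· ≥ ·) _ _).isCoboundedUnder_le
  refine integral_mono_of_nonneg (Eventually.of_forall fun x => ?_) ?_
    (Eventually.of_forall fun x => ?_)
  · exact le_limsup_of_frequently_le (Frequently.of_forall fun y => (hrange _).1.le) (hbdd x)
  · refine Integrable.of_bound (hcont.comp hw).aestronglyMeasurable 1
      (Eventually.of_forall fun x => ?_)
    rw [Real.norm_eq_abs, abs_of_pos (hrange _).1]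
    exact (hrange _).2.le
  · refine limsup_le_of_le (hcobdd x) (Eventually.of_forall fun y => hmono.monotone ?_)
    have h := huvw ((x - y) / a) (y / b)
    rwa [mul_div_cancel₀ _ ha.ne', mul_div_cancel₀ _ hb.ne', sub_add_cancel] at h

lemma hasDerivAt_measure_Iic_toReal {φ : ℝ → ℝ} (hφ : Continuous φ) (hpos : ∀ x, 0 < φ x)
    {μ : Measure ℝ} [IsFiniteMeasure μ]
    (hμ : μ = volume.withDensity fun x => ENNReal.ofReal (φ x)) (s : ℝ) :
    HasDerivAt (fun s => (μ (Set.Iic s)).toReal) (φ s) s := by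
  have hint : Integrable φ := by
    refine ⟨hφ.aestronglyMeasurable, ?_⟩
    rw [hasFiniteIntegral_iff_ofReal (Eventually.of_forall fun x => (hpos x).le)]
    have := measure_lt_top μ Set.univ
    rwa [hμ, withDensity_apply _ MeasurableSet.univ, Measure.restrict_univ] at this
  have heq : ∀ s, (μ (Set.Iic s)).toReal = ∫ x in Set.Iic s, φ x := fun s => by
    rw [hμ, withDensity_apply _ measurableSet_Iic, integral_eq_lintegral_of_nonneg_ae
      (Eventually.of_forall fun x => (hpos x).le) hφ.aestronglyMeasurable]
  have heq' : (fun s => (μ (Set.Iic s)).toReal) =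
      fun s => (∫ x in Set.Iic 0, φ x) + ∫ x in (0 : ℝ)..s, φ x := by
    funext s
    rw [heq, ← intervalIntegral.integral_Iic_sub_Iic hint.integrableOn hint.integrableOn]
    ring
  rw [heq']
  exact (intervalIntegral.integral_hasDerivAt_right (hφ.intervalIntegrable _ _)
    hφ.aestronglyMeasurable.stronglyMeasurableAtFilter hφ.continuousAt).const_add _

lemma integral_mem_Ioo {μ : Measure ℝ} [IsProbabilityMeasure μ] {F : ℝ → ℝ} (hF : Continuous F)
    (hrange : ∀ x, F x ∈ Set.Ioo (0 : ℝ) 1) : ∫ x, F x ∂μ ∈ Set.Ioo (0 : ℝ) 1 := by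
  have hint : Integrable F μ := by
    refine Integrable.of_bound hF.aestronglyMeasurable 1 (Eventually.of_forall fun x => ?_)
    rw [Real.norm_eq_abs, abs_of_pos (hrange _).1]
    exact (hrange _).2.le
  have hpos : ∀ {G : ℝ → ℝ}, Integrable G μ → (∀ x, 0 < G x) → 0 < ∫ x, G x ∂μ := by
    intro G hG h
    rw [integral_pos_iff_support_of_nonneg (fun x => (h x).le) hG,
      Function.support_eq_univ fun x => (h x).ne']
    simp
  refine ⟨hpos hint fun x => (hrange x).1, ?_⟩
  have hint' : Integrable (fun x => 1 - F x) μ := (integrable_const 1).sub hint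
  have h := hpos hint' fun x => sub_pos.2 (hrange x).2
  rw [integral_sub (integrable_const 1) hint] at h
  simpa using h

lemma integral_sub_sq_pos {μ : Measure ℝ} [IsProbabilityMeasure μ] [NullSingletonClass μ] (c : ℝ)
    (hint : Integrable (fun x => (x - c) ^ 2) μ) : 0 < ∫ x, (x - c) ^ 2 ∂μ := by
  rw [integral_pos_iff_support_of_nonneg (fun x => sq_nonneg _) hint]
  have : Function.support (fun x : ℝ => (x - c) ^ 2) = {c}ᶜ := by
    ext x
    simp [sub_eq_zero]
  rw [this, prob_compl_eq_one_sub (measurableSet_singleton c)]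
  simp

/-- necessary conditions on a measure satisfying the Ehrhard-type
inequality with its own distribution function. -/
theorem stmt8 (V : ℝ → ℝ) (hV : ContDiff ℝ 2 fun x => Real.exp (-V x))
    (μ : Measure ℝ)
    (hμ : μ = volume.withDensity fun x => ENNReal.ofReal (Real.exp (-V x)))
    (hprob : IsProbabilityMeasure μ)
    (hmom : Integrable (fun t => |t| ^ 5) μ)
    (a b : ℝ) (ha : 0 < a) (hb : 0 < b)
    (Φ : ℝ → ℝ) (hΦ : ∀ s, Φ s = (μ (Set.Iic s)).toReal)
    (Φi : ℝ → ℝ) (hΦi : ∀ x ∈ Set.Ioo (0 : ℝ) 1, Φ (Φi x) = x)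
    (H : ℝ × ℝ → ℝ)
    (hHdef : ∀ x y : ℝ, H (x, y) =
      if x = 0 ∨ y = 0 then 0
      else if x = 1 ∨ y = 1 then 1
      else Φ (a * Φi x + b * Φi y))
    (hstar : StarIneq1 a b (Set.Icc ((0 : ℝ), (0 : ℝ)) (1, 1)) H μ) :
    (∀ x y : ℝ, deriv V (a * x + b * y) ≤ a * deriv V x + b * deriv V y) ∧
    ((1 - a ^ 2 - b ^ 2) / (2 * a * b)) ^ 2 ≤ 1 ∧
    (1 < a + b → ∫ t, t ∂μ = 0) := by
  set φ : ℝ → ℝ := fun x => Real.exp (-V x) with hφdef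
  have hpos : ∀ x, 0 < φ x := fun x => Real.exp_pos _
  have hφc : Continuous φ := hV.continuous
  have hφd : ∀ x, HasDerivAt φ (deriv φ x) x := fun x =>
    ((hV.differentiable (by norm_num)) x).hasDerivAt
  have hderiv : ∀ x, HasDerivAt Φ (φ x) x := by
    rw [show Φ = fun s => (μ (Set.Iic s)).toReal from funext hΦ]
    exact hasDerivAt_measure_Iic_toReal hφc hpos hμ
  have hmono : StrictMono Φ := strictMono_of_deriv_pos fun x => by
    rw [(hderiv x).deriv]
    exact hpos x
  have hcont : Continuous Φ := continuous_iff_continuousAt.2 fun x => (hderiv x).continuousAt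
  have hrange : ∀ x, Φ x ∈ Set.Ioo (0 : ℝ) 1 := fun x => by
    constructor
    · refine lt_of_le_of_lt ?_ (hmono (sub_one_lt x))
      rw [hΦ]
      exact ENNReal.toReal_nonneg
    · refine lt_of_lt_of_le (hmono (lt_add_one x)) ?_
      rw [hΦ]
      exact measureReal_le_one
  have hH : ∀ x ∈ Set.Ioo (0 : ℝ) 1, ∀ y ∈ Set.Ioo (0 : ℝ) 1,
      H (x, y) = Φ (a * Φi x + b * Φi y) := fun x hx y hy => by
    rw [hHdef, if_neg (by simp [hx.1.ne', hy.1.ne']), if_neg (by simp [hx.2.ne, hy.2.ne])]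
  have : NullSingletonClass μ := by
    rw [hμ]
    infer_instance
  have hint2 : Integrable (fun x : ℝ => x ^ 2) μ := by
    refine ((integrable_const (1 : ℝ)).add hmom).mono'
      (by fun_prop : Continuous _).aestronglyMeasurable (Eventually.of_forall fun x => ?_)
    rw [Real.norm_eq_abs, abs_pow, Pi.add_apply]
    rcases le_total |x| 1 with h | h
    · have := pow_le_one₀ (n := 2) (abs_nonneg x) h
      have : 0 ≤ |x| ^ 5 := by positivity
      linarith
    · have := pow_le_pow_right₀ h (show 2 ≤ 5 by norm_num)
      linarith
  have hint1 : Integrable (fun x : ℝ => x) μ := by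
    refine ((integrable_const (1 : ℝ)).add hint2).mono'
      continuous_id.aestronglyMeasurable (Eventually.of_forall fun x => ?_)
    rw [Real.norm_eq_abs, Pi.add_apply, ← sq_abs]
    nlinarith [sq_nonneg (|x| - 1), abs_nonneg x]
  have hintΦ : ∀ {q : ℝ → ℝ}, Continuous q → Integrable (fun x => Φ (q x)) μ := fun hq =>
    Integrable.of_bound (hcont.comp hq).aestronglyMeasurable 1
      (Eventually.of_forall fun x => by
        rw [Real.norm_eq_abs, abs_of_pos (hrange _).1]
        exact (hrange _).2.le)
  have hmem : ∀ {q : ℝ → ℝ}, Continuous q → ∫ x, Φ (q x) ∂μ ∈ Set.Ioo (0 : ℝ) 1 := fun hq =>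
    integral_mem_Ioo (hcont.comp hq) fun x => hrange _
  have habs : ∀ x y, |Φ x - Φ y| ≤ 1 := fun x y => by
    rw [abs_le]
    constructor <;> linarith [(hrange x).1, (hrange x).2, (hrange y).1, (hrange y).2]
  -- expansions of `∫ Φ (s + ε q)` in `ε`
  have hexp1 : ∀ {q : ℝ → ℝ}, Continuous q → Integrable q μ → ∀ s,
      Tendsto (fun ε => (∫ x, Φ (s + ε * q x) ∂μ - Φ s) / ε ^ 1) (𝓝[>] 0)
        (𝓝 (φ s * ∫ x, q x ∂μ)) := by
    intro q hq hqi s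
    have h := tendsto_integral_comp_mul_div_pow (μ := μ) (R := fun h => Φ (s + h) - Φ s) (q := q)
      (k := 1) (L := φ s) (K := 1) one_ne_zero (by simp) (by fun_prop) hq
      ((hderiv s).tendsto_slope_zero.congr fun h => by simp [inv_mul_eq_div])
      (fun h => by linarith [habs (s + h) s, abs_nonneg h, pow_one |h|]) (by simpa using hqi)
    simp only [pow_one (q _)] at h
    refine h.congr fun ε => ?_
    rw [integral_div, integral_sub (hintΦ (by fun_prop)) (integrable_const _)]
    simp
  have hexp2 : ∀ {q : ℝ → ℝ}, Continuous q → Integrable q μ → Integrable (fun x => q x ^ 2) μ →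
      ∫ x, q x ∂μ = 0 → ∀ s,
      Tendsto (fun ε => (∫ x, Φ (s + ε * q x) ∂μ - Φ s) / ε ^ 2) (𝓝[>] 0)
        (𝓝 (φ s * (-deriv V s * ((∫ x, q x ^ 2 ∂μ) / 2)))) := by
    intro q hq hqi hqi2 hq0 s
    have hVs : deriv φ s = -deriv V s * φ s := by
      have hVd : DifferentiableAt ℝ V s := by
        have h1 : V = fun x => -Real.log (φ x) := by
          funext x
          simp [hφdef]
        rw [h1]
        exact ((hφd s).differentiableAt.log (hpos s).ne').neg
      have := (hVd.hasDerivAt.neg.exp).deriv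
      rw [mul_comm]
      exact this
    have h := tendsto_integral_comp_mul_div_pow (μ := μ)
      (R := fun h => Φ (s + h) - Φ s - h * φ s) (q := q)
      (k := 2) (L := deriv φ s / 2) (K := 1 + φ s) two_ne_zero (by simp) (by fun_prop) hq
      (tendsto_taylor_two hderiv (hφd s))
      (fun h => by
        have h1 := abs_sub (Φ (s + h) - Φ s) (h * φ s)
        rw [abs_mul, abs_of_pos (hpos s)] at h1
        have h2 := habs (s + h) s
        have h3 : |h| ≤ 1 + |h| ^ 2 := by nlinarith [sq_nonneg (|h| - 1), abs_nonneg h]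
        have h4 := mul_le_mul_of_nonneg_right h3 (hpos s).le
        nlinarith [sq_nonneg |h|]) hqi2
    have hL : deriv φ s / 2 * ∫ x, q x ^ 2 ∂μ =
        φ s * (-deriv V s * ((∫ x, q x ^ 2 ∂μ) / 2)) := by
      rw [hVs]
      ring
    rw [hL] at h
    refine h.congr fun ε => ?_
    have hi : Integrable (fun x => ε * q x * φ s) μ := (hqi.const_mul ε).mul_const _
    have hi' : Integrable (fun x => Φ (s + ε * q x)) μ := hintΦ (by fun_prop)
    have hi'' : Integrable (fun x => Φ (s + ε * q x) - Φ s) μ := hi'.sub (integrable_const _)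
    rw [integral_div, integral_sub hi'' hi,
      integral_sub hi' (integrable_const _), integral_mul_const, integral_const_mul, hq0]
    simp
  have hineq : ∀ {q₁ q₂ q₃ : ℝ → ℝ}, Continuous q₁ → Continuous q₂ → Continuous q₃ →
      (∀ x y, a * q₁ x + b * q₂ y ≤ q₃ (a * x + b * y)) → ∀ s t ε : ℝ, 0 ≤ ε →
      Φ (a * Φi (∫ x, Φ (s + ε * q₁ x) ∂μ) + b * Φi (∫ x, Φ (t + ε * q₂ x) ∂μ)) ≤
        ∫ x, Φ (a * s + b * t + ε * q₃ x) ∂μ := by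
    intro q₁ q₂ q₃ h₁ h₂ h₃ hq s t ε hε
    refine hstar.le_integral_comp ha hb hmono hcont hrange hΦi hH (by fun_prop) (by fun_prop)
      (by fun_prop) (fun x y => ?_) (hmem (by fun_prop)) (hmem (by fun_prop))
    linarith [mul_le_mul_of_nonneg_left (hq x y) hε]
  have hfirst : ∀ {q₁ q₂ q₃ : ℝ → ℝ}, Continuous q₁ → Continuous q₂ → Continuous q₃ →
      Integrable q₁ μ → Integrable q₂ μ → Integrable q₃ μ →
      (∀ x y, a * q₁ x + b * q₂ y ≤ q₃ (a * x + b * y)) →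
      a * ∫ x, q₁ x ∂μ + b * ∫ x, q₂ x ∂μ ≤ ∫ x, q₃ x ∂μ := by
    intro q₁ q₂ q₃ h₁ h₂ h₃ hi₁ hi₂ hi₃ hq
    exact coeff_le_of_expansions (s := 0) (t := 0) ha hb one_ne_zero hmono hderiv hpos hΦi
      (fun ε => hmem (by fun_prop)) (fun ε => hmem (by fun_prop))
      (hexp1 h₁ hi₁ 0) (hexp1 h₂ hi₂ 0) (hexp1 h₃ hi₃ _)
      (hineq h₁ h₂ h₃ hq 0 0)
  set m := ∫ t, t ∂μ with hm
  have hmab : a * m + b * m = m := by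
    apply le_antisymm
    · exact hfirst continuous_id continuous_id continuous_id hint1 hint1 hint1 fun x y => le_rfl
    · have := hfirst (q₁ := fun x => -x) (q₂ := fun x => -x) (q₃ := fun x => -x) continuous_neg
        continuous_neg continuous_neg hint1.neg hint1.neg hint1.neg fun x y => by
          linarith
      rw [integral_neg] at this
      linarith
  have hM2 : 0 < ∫ x, x ^ 2 ∂μ := by
    simpa using integral_sub_sq_pos (μ := μ) 0 (by simpa using hint2)
  refine ⟨fun s t => ?_, ?_, fun hab => ?_⟩
  · have hi1 : Integrable (fun x => x - m) μ := hint1.sub (integrable_const m)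
    have hi2 : Integrable (fun x => (x - m) ^ 2) μ := by
      have := (hint2.sub (hint1.const_mul (2 * m))).add (integrable_const (m ^ 2))
      refine this.congr (Eventually.of_forall fun x => ?_)
      simp only [Pi.add_apply, Pi.sub_apply]
      ring
    have h0 : ∫ x, (x - m) ∂μ = 0 := by
      rw [integral_sub hint1 (integrable_const m)]
      simp [hm]
    have hσ := integral_sub_sq_pos m hi2
    have hc : Continuous fun x : ℝ => x - m := by fun_prop
    have h := coeff_le_of_expansions (s := s) (t := t) ha hb two_ne_zero hmono hderiv hpos hΦi
      (fun ε => hmem (by fun_prop)) (fun ε => hmem (by fun_prop))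
      (hexp2 hc hi1 hi2 h0 s) (hexp2 hc hi1 hi2 h0 t) (hexp2 hc hi1 hi2 h0 _)
      (hineq hc hc hc (fun x y => by linarith) s t)
    have h' : deriv V (a * s + b * t) * ((∫ x, (x - m) ^ 2 ∂μ) / 2) ≤
        (a * deriv V s + b * deriv V t) * ((∫ x, (x - m) ^ 2 ∂μ) / 2) := by linarith
    exact le_of_mul_le_mul_right h' (by positivity)
  · have hsq : Continuous fun x : ℝ => x ^ 2 := by fun_prop
    have hsum : 1 ≤ (a + b) ^ 2 := by
      have h := hfirst (q₁ := fun x => -x ^ 2) (q₂ := fun x => -x ^ 2)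
        (q₃ := fun x => (-1 / (a + b)) * x ^ 2) hsq.neg hsq.neg (by fun_prop) hint2.neg hint2.neg
        (hint2.const_mul _) fun x y => by
          rw [div_mul_eq_mul_div, le_div_iff₀ (by positivity)]
          nlinarith [mul_nonneg (mul_pos ha hb).le (sq_nonneg (x - y))]
      rw [integral_neg, integral_const_mul, div_mul_eq_mul_div, le_div_iff₀ (by positivity)] at h
      nlinarith
    have hsub : (a - b) ^ 2 ≤ 1 := by
      rcases lt_trichotomy a b with hab | hab | hab
      · have hpos' : 0 < b - a := sub_pos.2 hab
        have h := hfirst (q₁ := fun x => -x ^ 2) (q₂ := fun x => x ^ 2)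
          (q₃ := fun x => (1 / (b - a)) * x ^ 2) hsq.neg hsq (by fun_prop) hint2.neg hint2
          (hint2.const_mul _) fun x y => by
            rw [div_mul_eq_mul_div, le_div_iff₀ hpos']
            nlinarith [mul_nonneg (mul_pos ha hb).le (sq_nonneg (x + y))]
        rw [integral_neg, integral_const_mul, div_mul_eq_mul_div, le_div_iff₀ hpos'] at h
        nlinarith
      · simp [hab]
      · have hpos' : 0 < a - b := sub_pos.2 hab
        have h := hfirst (q₁ := fun x => x ^ 2) (q₂ := fun x => -x ^ 2)
          (q₃ := fun x => (1 / (a - b)) * x ^ 2) hsq hsq.neg (by fun_prop) hint2 hint2.neg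
          (hint2.const_mul _) fun x y => by
            rw [div_mul_eq_mul_div, le_div_iff₀ hpos']
            nlinarith [mul_nonneg (mul_pos ha hb).le (sq_nonneg (x + y))]
        rw [integral_neg, integral_const_mul, div_mul_eq_mul_div, le_div_iff₀ hpos'] at h
        nlinarith
    have hab : 0 < 2 * a * b := by positivity
    rw [sq_le_one_iff_abs_le_one, abs_le, le_div_iff₀ hab, div_le_iff₀ hab]
    constructor <;> nlinarith
  · have : (a + b - 1) * m = 0 := by linarith
    exact (mul_eq_zero.1 this).resolve_left (by linarith)

end
end
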